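/- For all n ≥ 4, FC(3,n) = ⌊n/2⌋ + 1: every family of ⌊n/2⌋ + 1 distinct 3-element subsets of [n] generates a Frankl-Complete family, and there exists a family of ⌊n/2⌋ distinct 3-element subsets of [n] whose generated union-closed family is Non–Frankl-Complete. -/

import Mathlib

/-- A family of sets is union-closed. -/
def UC (F : Finset (Finset ℕ)) : Prop := ∀ A ∈ F, ∀ B ∈ F, A ∪ B ∈ F

/-- `famU F` is the union `U(F)` of all members of the family `F`. -/
def famU (F : Finset (Finset ℕ)) : Finset ℕ := F.sup id

/-- `memFam F i` is the subfamily `F_i` of sets in `F` containing `i`. -/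
def memFam (F : Finset (Finset ℕ)) (i : ℕ) : Finset (Finset ℕ) :=
  F.filter (fun S => i ∈ S)

/-- `A` is Frankl-Complete: every union-closed family containing `A` has an
element of `U(A)` belonging to at least half of its sets. -/
def FC (A : Finset (Finset ℕ)) : Prop :=
  ∀ F : Finset (Finset ℕ), UC F → A ⊆ F →
    ∃ i ∈ famU A, 2 * (memFam F i).card ≥ F.card

/-- `A` is Non–Frankl-Complete: some union-closed family containing `A` has every
element of `U(A)` in fewer than half of its sets. -/
def NonFC (A : Finset (Finset ℕ)) : Prop :=
  ∃ F : Finset (Finset ℕ), UC F ∧ A ⊆ F ∧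
    ∀ i ∈ famU A, 2 * (memFam F i).card < F.card

/-- `gen S` is the union-closed family generated by `S`: the smallest
union-closed family containing `S`, given explicitly as all unions of
nonempty subfamilies of `S`. -/
def gen (S : Finset (Finset ℕ)) : Finset (Finset ℕ) :=
  (S.powerset.filter (fun T => T.Nonempty)).image (fun T => T.sup id)

/-- A branching certificate for lower bounds over union-closed families of bit masks. At every
node the pushes coded by `a` are carried out; a `br` node then splits on the membership of the
mask `S`. -/
inductive Certificate
  | leaf (a : ℕ)
  | br (a S : ℕ) (t u : Certificate)

namespace Packed

/-- The base of packed potentials. -/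
def W : ℕ := 268435456

/-- The bias of packed potentials: the digit `d` stands for the integer `d - H`. -/
def H : ℕ := 134217728

/-- The digit of `R` at position `S`. -/
def field (R S : ℕ) : ℕ := R / W ^ S % W

/-- Replace the digit of `R` at position `S` by `b`. -/
def put (R S b : ℕ) : ℕ := R + b * W ^ S - field R S * W ^ S

/-- Increase the digit at `S` and decrease the digit at `T` by `c`. -/
def transfer (R S T c : ℕ) : ℕ := R + c * W ^ S - c * W ^ T

/-- Move as much of the negative part at `S` as possible to the positive part at `T`. -/
def push (R S T : ℕ) : ℕ :=
  transfer R S T ((H - field R S) - ((H - field R S) - (field R T - H)))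

/-- Carry out the pushes coded by the digits of `A`. -/
def pushes (N : ℕ) (gens : List ℕ) : ℕ → ℕ → ℕ → ℕ
  | 0, _, R => R
  | k + 1, A, R =>
    if A = 0 then R else
      let d := A % (N * 256) - 1
      pushes N gens k (A / (N * 256)) (push R (d % N) ((d % N ||| gens.getD (d / N) 0) % N))

/-- Account for masks known to be members. -/
def settle (N : ℕ) : List ℕ → ℕ → ℕ → ℕ → (ℕ → ℕ → ℕ → Bool) → Bool
  | [], R, p, q, k => k R p q
  | U :: L, R, p, q, k =>
    settle N L (put R (U % N) H) (p + field R (U % N)) (q + H) k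

/-- The total negative part of the first `n` digits. -/
def debt : ℕ → ℕ → ℕ
  | 0, _ => 0
  | n + 1, R => (H - R % W) + debt n (R / W)

/-- Add to `g` those members of the list that are not yet recorded in the bit vector `M`. -/
def mergeAux : List ℕ → ℕ → List ℕ → List ℕ
  | g, _, [] => g
  | g, M, U :: L =>
    bif Nat.beq (M / 2 ^ U % 2) 1 then mergeAux g M L else mergeAux (U :: g) (M + 2 ^ U) L

/-- Add to `g` those members of `L` that are not yet present. -/
def merge (g L : List ℕ) : List ℕ := mergeAux g (g.foldl (fun M U => M ||| 2 ^ U) 0) L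

/-- Check that `p - q` plus the packed potential `R` is nonnegative. -/
def check (N : ℕ) : Certificate → List ℕ → ℕ → ℕ → ℕ → Bool
  | .leaf a, gens, R, p, q => Nat.ble (q + debt N (pushes N gens 500 a R)) p
  | .br a S t u, gens, R, p, q =>
    let R' := pushes N gens 500 a R
    let L := S % N :: gens.map (S % N ||| ·)
    settle N L R' p q (fun R'' p' q' => check N t (merge gens L) R'' p' q') &&
    check N u gens (put R' (S % N) (W - 1)) p q

lemma W_pos (n : ℕ) : 0 < W ^ n := pow_pos (by decide) n

lemma field_lt (R S : ℕ) : field R S < W := Nat.mod_lt _ (by decide)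

lemma field_mul_le (R S : ℕ) : field R S * W ^ S ≤ R :=
  (Nat.mul_le_mul_right _ (Nat.mod_le _ _)).trans (Nat.div_mul_le_self _ _)

lemma field_add {R S c : ℕ} (h : field R S + c < W) (T : ℕ) :
    field (R + c * W ^ S) T = if T = S then field R S + c else field R T := by
  unfold field at *
  rcases lt_trichotomy T S with hT | rfl | hT
  · obtain ⟨k, rfl⟩ := Nat.exists_eq_add_of_lt hT
    rw [if_neg (by omega), show c * W ^ (T + k + 1) = (W * (c * W ^ k)) * W ^ T by ring,
      Nat.add_mul_div_right _ _ (W_pos T), Nat.add_mul_mod_self_left]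
  · rw [if_pos rfl, Nat.add_mul_div_right _ _ (W_pos T)]
    rw [Nat.add_mod, Nat.mod_eq_of_lt (a := c) (by omega), Nat.mod_eq_of_lt h]
  · obtain ⟨k, rfl⟩ := Nat.exists_eq_add_of_lt hT
    rw [if_neg (by omega), show W ^ (S + k + 1) = W ^ S * W * W ^ k by ring,
      ← Nat.div_div_eq_div_mul, ← Nat.div_div_eq_div_mul, ← Nat.div_div_eq_div_mul,
      ← Nat.div_div_eq_div_mul, Nat.add_mul_div_right _ _ (W_pos S)]
    congr 2
    unfold W at *
    omega

lemma field_sub {R S c : ℕ} (h : c ≤ field R S) (T : ℕ) :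
    field (R - c * W ^ S) T = if T = S then field R S - c else field R T := by
  have hle : c * W ^ S ≤ R := (Nat.mul_le_mul_right _ h).trans (field_mul_le R S)
  have hS : field (R - c * W ^ S) S = field R S - c := by
    have h1 := Nat.sub_mul_div R (W ^ S) c
    rw [mul_comm] at h1
    unfold field at *
    rw [h1]
    generalize R / W ^ S = x at *
    have hx := Nat.mod_add_div x W
    rw [show x - c = x % W - c + W * (x / W) by omega, Nat.add_mul_mod_self_left,
      Nat.mod_eq_of_lt ((Nat.sub_le _ _).trans_lt (Nat.mod_lt _ (by decide)))]
  have h2 := field_add (R := R - c * W ^ S) (S := S) (c := c)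
    (by rw [hS]; have := field_lt R S; omega) T
  rw [Nat.sub_add_cancel hle] at h2
  split_ifs at h2 ⊢ with hT
  · rw [hT, hS]
  · exact h2.symm

lemma field_put {R S b : ℕ} (hb : b < W) (T : ℕ) :
    field (put R S b) T = if T = S then b else field R T := by
  have hle := field_mul_le R S
  have h0 : field (R - field R S * W ^ S) S = 0 := by rw [field_sub le_rfl]; simp
  have : put R S b = (R - field R S * W ^ S) + b * W ^ S := by unfold put; omega
  rw [this, field_add (by omega), h0, field_sub le_rfl]
  split_ifs <;> simp

lemma field_transfer {R S T c : ℕ} (hST : S ≠ T) (hS : field R S + c < W) (hT : c ≤ field R T)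
    (U : ℕ) : field (transfer R S T c) U =
      if U = T then field R T - c else if U = S then field R S + c else field R U := by
  have h1 : field (R + c * W ^ S) T = field R T := by
    rw [field_add hS, if_neg hST.symm]
  unfold transfer
  rw [field_sub (by rw [h1]; exact hT), h1, field_add hS]

section Value

variable (P : ℕ → Prop) [DecidablePred P] (N : ℕ)

/-- The sum of the packed potential `R` over the masks below `N` that satisfy `P`. -/
def val (R : ℕ) : ℤ := ∑ S ∈ Finset.range N, if P S then (field R S : ℤ) - H else 0

variable {P N}

lemma val_eq_add {R R' S : ℕ} (hS : S < N) (h : ∀ T, T ≠ S → field R' T = field R T) :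
    val P N R' = val P N R + if P S then (field R' S : ℤ) - field R S else 0 := by
  unfold val
  have hm := Finset.mem_range.2 hS
  rw [← Finset.add_sum_erase _ _ hm, ← Finset.add_sum_erase (Finset.range N)
    (fun S => if P S then (field R S : ℤ) - H else 0) hm,
    Finset.sum_congr rfl (g := fun S => if P S then (field R S : ℤ) - H else 0)
      (fun T hT => by rw [h T (Finset.ne_of_mem_erase hT)])]
  split_ifs <;> ring

lemma val_put {R S b : ℕ} (hS : S < N) (hb : b < W) :
    val P N (put R S b) = val P N R + if P S then (b : ℤ) - field R S else 0 := by
  rw [val_eq_add (R := R) hS fun T hT => by rw [field_put hb, if_neg hT], field_put hb, if_pos rfl]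

lemma val_push {R S T : ℕ} (hS : S < N) (hT : T < N) (hP : P S → P T) :
    val P N (push R S T) ≤ val P N R := by
  have hSW := field_lt R S
  have hHW : H < W := by decide
  unfold push
  generalize hc : (H - field R S) - ((H - field R S) - (field R T - H)) = c
  by_cases hST : S = T
  · subst hST
    have : c = 0 := by omega
    simp [this, transfer]
  have h1 : field R S + c < W := by omega
  have h2 : c ≤ field R T := by omega
  have hf := field_transfer hST h1 h2
  have h3 : val P N (R + c * W ^ S) = val P N R + if P S then (c : ℤ) else 0 := by
    rw [val_eq_add (R := R) hS fun U hU => by rw [field_add h1, if_neg hU], field_add h1, if_pos rfl]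
    simp
  have h4 : field (R + c * W ^ S) T = field R T := by rw [field_add h1, if_neg (Ne.symm hST)]
  have h5 : val P N (transfer R S T c) = val P N (R + c * W ^ S) + if P T then -(c : ℤ) else 0 := by
    rw [transfer, val_eq_add (R := R + c * W ^ S) hT
        fun U hU => by rw [field_sub (by rwa [h4]), if_neg hU],
      field_sub (by rwa [h4]), if_pos rfl, h4]
    push_cast [h2]
    simp
  rw [h5, h3]
  by_cases hS' : P S
  · rw [if_pos hS', if_pos (hP hS')]
    linarith
  · rw [if_neg hS']
    split_ifs <;> linarith [Int.natCast_nonneg c]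

lemma val_pushes (hN : ∀ S, P S → S < N) (hpos : 0 < N) {gens : List ℕ}
    (hg : ∀ g ∈ gens, ∀ S, P S → P (S ||| g)) (k A R : ℕ) :
    val P N (pushes N gens k A R) ≤ val P N R := by
  induction k generalizing A R with
  | zero => simp [pushes]
  | succ k ih =>
    unfold pushes
    split_ifs
    · exact le_rfl
    refine (ih _ _).trans (val_push (Nat.mod_lt _ hpos) (Nat.mod_lt _ hpos) fun h => ?_)
    rw [List.getD_eq_getElem?_getD]
    cases hx : gens[(A % (N * 256) - 1) / N]? with
    | none => simpa using h
    | some g =>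
      have := hg g (List.mem_of_getElem? hx) _ h
      rw [Option.getD_some, Nat.mod_eq_of_lt (hN _ this)]
      exact this

lemma debt_eq (n R : ℕ) : debt n R = ∑ S ∈ Finset.range n, (H - field R S) := by
  induction n generalizing R with
  | zero => simp [debt]
  | succ n ih =>
    rw [debt, ih, Finset.sum_range_succ']
    simp [field, Nat.div_div_eq_div_mul, pow_succ', add_comm]

lemma neg_debt_le_val (R : ℕ) : -(debt N R : ℤ) ≤ val P N R := by
  rw [debt_eq, val]
  push_cast
  rw [← Finset.sum_neg_distrib]
  refine Finset.sum_le_sum fun S _ => ?_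
  split_ifs <;> omega

lemma mem_mergeAux {g L : List ℕ} {M U : ℕ} (h : U ∈ mergeAux g M L) : U ∈ g ∨ U ∈ L := by
  induction L generalizing g M with
  | nil => exact .inl h
  | cons V L ih =>
    rw [mergeAux, Bool.cond_eq_ite] at h
    split_ifs at h <;> have := ih h <;> simp only [List.mem_cons] at this ⊢ <;> tauto

lemma mem_merge {g L : List ℕ} {U : ℕ} (h : U ∈ merge g L) : U ∈ g ∨ U ∈ L := mem_mergeAux h

lemma exists_of_settle (hN : ∀ S, P S → S < N) {L : List ℕ}
    (hL : ∀ U ∈ L, P U) {R p q : ℕ} {k : ℕ → ℕ → ℕ → Bool}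
    (h : settle N L R p q k = true) :
    ∃ R' p' q', k R' p' q' = true ∧ (p' : ℤ) - q' + val P N R' = p - q + val P N R := by
  induction L generalizing R p q with
  | nil => exact ⟨R, p, q, h, rfl⟩
  | cons U L ih =>
    obtain ⟨R', p', q', hk, he⟩ := ih (fun V hV => hL V (List.mem_cons_of_mem _ hV)) h
    refine ⟨R', p', q', hk, ?_⟩
    have hPU := hL U List.mem_cons_self
    have hUN := hN U hPU
    rw [he, Nat.mod_eq_of_lt hUN, val_put hUN (by decide), if_pos hPU]
    push_cast
    ring

lemma le_of_check (hN : ∀ S, P S → S < N)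
    (hU : ∀ S T, P S → P T → P (S ||| T)) (hpos : 0 < N) (t : Certificate) {gens : List ℕ}
    (hg : ∀ g ∈ gens, ∀ S, P S → P (S ||| g)) {R p q : ℕ} (h : check N t gens R p q = true) :
    0 ≤ (p : ℤ) - q + val P N R := by
  induction t generalizing gens R p q with
  | leaf a =>
    rw [check] at h
    have h1 := Nat.le_of_ble_eq_true h
    have h2 := val_pushes hN hpos hg 500 a R
    have h3 := neg_debt_le_val (P := P) (N := N) (pushes N gens 500 a R)
    omega
  | br a S t u iht ihu =>
    rw [check] at h
    simp only [Bool.and_eq_true] at h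
    have h2 := val_pushes hN hpos hg 500 a R
    set R' := pushes N gens 500 a R
    have hSN := Nat.mod_lt S hpos
    by_cases hS : P (S % N)
    · have hL : ∀ U ∈ S % N :: gens.map (S % N ||| ·), P U := by
        intro U hU
        simp only [List.mem_cons, List.mem_map] at hU
        rcases hU with rfl | ⟨g, hgm, rfl⟩
        · exact hS
        · exact hg g hgm _ hS
      obtain ⟨R'', p', q', hk, he⟩ := exists_of_settle hN hL h.1
      have := iht (fun g hgm T hT => by
        rcases mem_merge hgm with hgm | hgm
        · exact hg g hgm T hT
        · exact hU _ _ hT (hL g hgm)) hk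
      omega
    · have h3 := ihu hg h.2
      rw [val_put hSN (by decide), if_neg hS] at h3
      omega

end Value

end Packed

/-- `Good N E φ` says that `φ` has nonnegative sum over every union-closed family of masks below `N`
that is closed under the union with each of the masks in `E`. -/
def Good (N : ℕ) (E : List ℕ) (φ : ℕ → ℤ) : Prop :=
  ∀ (P : ℕ → Prop) [DecidablePred P], (∀ S, P S → S < N) → (∀ S T, P S → P T → P (S ||| T)) →
    (∀ e ∈ E, ∀ S, P S → P (S ||| e)) → 0 ≤ ∑ S ∈ Finset.range N, if P S then φ S else 0

namespace Packed

/-- The packed form of the potential `φ` on the masks below `n`. -/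
def pack (φ : ℕ → ℤ) : ℕ → ℕ
  | 0 => 0
  | n + 1 => pack φ n + (φ n + H).toNat * W ^ n

/-- The nonempty unions of the masks in a list. -/
def unions (E : List ℕ) : List ℕ := E.foldl (fun g e => merge g (e :: g.map (e ||| ·))) []

/-- The values of `φ` on the masks below `n` fit into one digit. -/
def fits (φ : ℕ → ℤ) : ℕ → Bool
  | 0 => true
  | n + 1 => fits φ n && (decide (-(H : ℤ) ≤ φ n) && decide (φ n < H))

lemma bounds_of_fits {φ : ℕ → ℤ} {n : ℕ} (h : fits φ n = true) {S : ℕ} (hS : S < n) :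
    -(H : ℤ) ≤ φ S ∧ φ S < H := by
  induction n with
  | zero => omega
  | succ n ih =>
    simp only [fits, Bool.and_eq_true, decide_eq_true_eq] at h
    rcases Nat.lt_succ_iff_lt_or_eq.1 hS with hS | rfl
    · exact ih h.1 hS
    · exact h.2

lemma pack_lt {φ : ℕ → ℤ} {n : ℕ} (h : fits φ n = true) : pack φ n < W ^ n := by
  induction n with
  | zero => simp [pack]
  | succ n ih =>
    have hb := bounds_of_fits h (Nat.lt_succ_self n)
    simp only [fits, Bool.and_eq_true] at h
    have h1 : (φ n + H).toNat + 1 ≤ W := by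
      have : W = H + H := rfl
      omega
    calc pack φ n + (φ n + H).toNat * W ^ n < W ^ n + (φ n + H).toNat * W ^ n := by
          have := ih h.1; omega
      _ = ((φ n + H).toNat + 1) * W ^ n := by ring
      _ ≤ W * W ^ n := Nat.mul_le_mul_right _ h1
      _ = W ^ (n + 1) := by ring

lemma field_pack {φ : ℕ → ℤ} {n : ℕ} (h : fits φ n = true) {S : ℕ} (hS : S < n) :
    (field (pack φ n) S : ℤ) = φ S + H := by
  induction n with
  | zero => omega
  | succ n ih =>
    have hb := bounds_of_fits h (Nat.lt_succ_self n)
    simp only [fits, Bool.and_eq_true] at h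
    have h0 : field (pack φ n) n = 0 := by
      rw [field, Nat.div_eq_of_lt (pack_lt h.1), Nat.zero_mod]
    have hW : W = H + H := rfl
    rw [pack, field_add (by rw [h0]; omega), h0]
    split_ifs with hSn
    · subst hSn
      omega
    · exact ih h.1 (by omega)

lemma good_of_check {N : ℕ} {E : List ℕ} {φ : ℕ → ℤ} (t : Certificate) (hN : 0 < N)
    (h : (fits φ N && check N t (unions E) (pack φ N) 0 0) = true) : Good N E φ := by
  intro P _ hP hU hE
  rw [Bool.and_eq_true] at h
  have hg : ∀ g ∈ unions E, ∀ S, P S → P (S ||| g) := by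
    have key : ∀ (L g : List ℕ), (∀ e ∈ L, ∀ S, P S → P (S ||| e)) →
        (∀ u ∈ g, ∀ S, P S → P (S ||| u)) →
        ∀ u ∈ L.foldl (fun g e => merge g (e :: g.map (e ||| ·))) g, ∀ S, P S → P (S ||| u) := by
      intro L
      induction L with
      | nil => intro g _ hg; exact hg
      | cons e L ih =>
        intro g hL hg
        refine ih _ (fun f hf => hL f (List.mem_cons_of_mem _ hf)) fun u hu S hS => ?_
        have he := hL e List.mem_cons_self
        rcases mem_merge hu with hu | hu
        · exact hg u hu S hS
        · simp only [List.mem_cons, List.mem_map] at hu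
          rcases hu with rfl | ⟨v, hv, rfl⟩
          · exact he S hS
          · rw [← Nat.or_assoc]
            exact hg v hv _ (he S hS)
    exact key E [] hE (by simp)
  have := le_of_check hP hU hN t hg h.2
  simp only [Nat.cast_zero, sub_zero, zero_add] at this
  refine this.trans_eq (Finset.sum_congr rfl fun S hS => ?_)
  rw [field_pack h.1 (Finset.mem_range.1 hS)]
  simp

end Packed

/-- The linear potential with weights `w`. -/
def lin : List ℤ → ℕ → ℤ
  | [], _ => 0
  | w :: l, S => (if S % 2 = 1 then w else -w) + lin l (S / 2)

/-- The relaxed potential obtained from `φ` when the bits `a` and `b` are interchangeable. -/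
def twin (a b : ℕ) (φ : ℕ → ℤ) (S : ℕ) : ℤ :=
  if S / 2 ^ a % 2 = S / 2 ^ b % 2 then φ S else if S / 2 ^ b % 2 = 1 then 0 else 2 * φ S

/-- The end potential of a chain. -/
def tail (S : ℕ) : ℤ :=
  [0, 1197, -3427, -8128, 0, -1667, 1389, 4746, 3427, -2154, 0, -4560, -1389, 1528, 0, 1895, -1197, 0,
    2154, -6156, 1667, 0, -1528, 3806, 8128, 6156, 4560, 0, -4746, -3806, -1895, 0].getD S 0

/-- The potential for the first edges of a chain. -/
def headPotential (S : ℕ) : ℤ := lin [5698, 5698, 3683, 8472, 5640, 4588] S + tail (S / 8)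

/-- The potential for three consecutive edges of a chain. -/
def linkPotential (S : ℕ) : ℤ := lin [0, 0, 5000, 6017, 5000] S - tail (S % 32) + tail (S / 4)

/-- Interchange the bits `a` and `b`. -/
def swapBits (a b S : ℕ) : ℕ :=
  if S.testBit a = S.testBit b then S else S ^^^ (2 ^ a ||| 2 ^ b)

lemma testBit_swapBits {a b : ℕ} (S i : ℕ) :
    (swapBits a b S).testBit i = S.testBit (Equiv.swap a b i) := by
  unfold swapBits
  have ha := @Nat.testBit_two_pow a i
  have hb := @Nat.testBit_two_pow b i
  split_ifs with h
  · by_cases hia : i = a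
    · subst hia; simp [h]
    by_cases hib : i = b
    · subst hib; simp [h]
    rw [Equiv.swap_apply_of_ne_of_ne hia hib]
  · rw [Nat.testBit_xor, Nat.testBit_or, ha, hb]
    by_cases hia : i = a
    · subst hia; simp; revert h; cases S.testBit i <;> cases S.testBit b <;> simp
    by_cases hib : i = b
    · subst hib; simp; revert h; cases S.testBit i <;> cases S.testBit a <;> simp
    rw [Equiv.swap_apply_of_ne_of_ne hia hib]
    simp [Ne.symm hia, Ne.symm hib]

lemma swapBits_swapBits (a b S : ℕ) : swapBits a b (swapBits a b S) = S :=
  Nat.eq_of_testBit_eq fun i => by simp [testBit_swapBits]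

lemma swapBits_or (a b S T : ℕ) :
    swapBits a b (S ||| T) = swapBits a b S ||| swapBits a b T :=
  Nat.eq_of_testBit_eq fun i => by simp [testBit_swapBits]

lemma swapBits_lt {a b n S : ℕ} (ha : a < n) (hb : b < n) (hS : S < 2 ^ n) :
    swapBits a b S < 2 ^ n := by
  unfold swapBits
  split_ifs
  · exact hS
  · exact Nat.xor_lt_two_pow hS (Nat.or_lt_two_pow (Nat.pow_lt_pow_right (by simp) ha)
      (Nat.pow_lt_pow_right (by simp) hb))

lemma twin_add_twin {a b : ℕ} {φ : ℕ → ℤ} {S : ℕ} (h : φ (swapBits a b S) = φ S) :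
    twin a b φ S + twin a b φ (swapBits a b S) = 2 * φ S := by
  have h1 : ∀ c, (swapBits a b S / 2 ^ c % 2) = S / 2 ^ (Equiv.swap a b c) % 2 := fun c => by
    simp only [← Nat.toNat_testBit, testBit_swapBits]
  unfold twin
  rw [h, h1, h1, Equiv.swap_apply_left, Equiv.swap_apply_right]
  split_ifs <;> omega

lemma Good.of_twin {n a b : ℕ} {E : List ℕ} {φ : ℕ → ℤ} (h : Good (2 ^ n) E (twin a b φ))
    (ha : a < n) (hb : b < n) (hE : ∀ e ∈ E, swapBits a b e = e)
    (hφ : ∀ S < 2 ^ n, φ (swapBits a b S) = φ S) : Good (2 ^ n) E φ := by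
  intro P _ hP hU hPE
  have h1 := h P hP hU hPE
  have h2 := h (fun S => P (swapBits a b S))
    (fun S hS => by simpa [swapBits_swapBits] using swapBits_lt ha hb (hP _ hS))
    (fun S T hS hT => by rw [swapBits_or]; exact hU _ _ hS hT)
    (fun e he S hS => by rw [swapBits_or, hE e he]; exact hPE e he _ hS)
  have h3 : (∑ S ∈ Finset.range (2 ^ n), if P (swapBits a b S) then twin a b φ S else 0) =
      ∑ S ∈ Finset.range (2 ^ n), if P S then twin a b φ (swapBits a b S) else 0 := by
    have hm : ∀ S ∈ Finset.range (2 ^ n), swapBits a b S ∈ Finset.range (2 ^ n) := fun S hS =>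
      Finset.mem_range.2 (swapBits_lt ha hb (Finset.mem_range.1 hS))
    refine Finset.sum_nbij' (swapBits a b) (swapBits a b) hm hm
      (fun _ _ => swapBits_swapBits ..) (fun _ _ => swapBits_swapBits ..) fun S _ => ?_
    simp only [swapBits_swapBits]
  rw [h3] at h2
  have h4 := add_nonneg h1 h2
  rw [← Finset.sum_add_distrib, Finset.sum_congr rfl (g := fun S => 2 * if P S then φ S else 0),
    ← Finset.mul_sum] at h4
  · linarith
  · intro S hS
    split_ifs
    · exact twin_add_twin (hφ S (Finset.mem_range.1 hS))
    · simp

/-- The mask of those members of the list `v` that lie in `A`. -/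
def code : List ℕ → Finset ℕ → ℕ
  | [], _ => 0
  | x :: v, A => Nat.bit (decide (x ∈ A)) (code v A)

/-- The set of those members of a list that are selected by a mask. -/
def select : List ℕ → ℕ → Finset ℕ
  | [], _ => ∅
  | x :: v, S => if S % 2 = 1 then insert x (select v (S / 2)) else select v (S / 2)

lemma code_union (v : List ℕ) (A B : Finset ℕ) : code v (A ∪ B) = code v A ||| code v B := by
  induction v with
  | nil => simp [code]
  | cons x v ih => simp [code, ih, Nat.lor_bit]

lemma code_lt (v : List ℕ) (A : Finset ℕ) : code v A < 2 ^ v.length := by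
  induction v with
  | nil => simp [code]
  | cons x v ih =>
    rw [code, List.length_cons, pow_succ', Nat.bit_val]
    have := Bool.toNat_le (decide (x ∈ A))
    omega

lemma mem_iff_of_code_eq {v : List ℕ} {A B : Finset ℕ} (h : code v A = code v B) {x : ℕ}
    (hx : x ∈ v) : x ∈ A ↔ x ∈ B := by
  induction v with
  | nil => simp at hx
  | cons y v ih =>
    simp only [code, Nat.bit_val] at h
    rcases List.mem_cons.1 hx with rfl | hx
    · by_cases h1 : x ∈ A <;> by_cases h2 : x ∈ B <;> simp [h1, h2] at h ⊢ <;> omega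
    · refine ih ?_ hx
      have h1 := Bool.toNat_le (decide (y ∈ A))
      have h2 := Bool.toNat_le (decide (y ∈ B))
      omega

lemma select_subset (v : List ℕ) (S : ℕ) : select v S ⊆ v.toFinset := by
  induction v generalizing S with
  | nil => simp [select]
  | cons x v ih =>
    rw [select, List.toFinset_cons]
    split_ifs
    · exact Finset.insert_subset_insert _ (ih _)
    · exact (ih _).trans (Finset.subset_insert _ _)

lemma code_insert_of_notMem {v : List ℕ} {x : ℕ} (hx : x ∉ v) (A : Finset ℕ) :
    code v (insert x A) = code v A := by
  induction v with
  | nil => rfl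
  | cons y v ih =>
    simp only [List.mem_cons, not_or] at hx
    simp [code, ih hx.2, Ne.symm hx.1]

lemma code_select {v : List ℕ} (hv : v.Nodup) {S : ℕ} (hS : S < 2 ^ v.length) :
    code v (select v S) = S := by
  induction v generalizing S with
  | nil => simp only [List.length_nil, pow_zero] at hS; simp [code]; omega
  | cons x v ih =>
    rw [List.nodup_cons] at hv
    rw [List.length_cons, pow_succ'] at hS
    have h := ih hv.2 (S := S / 2) (by omega)
    have hx : x ∉ select v (S / 2) := fun hx => hv.1 (by simpa using select_subset _ _ hx)
    rw [select, code, Nat.bit_val]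
    split_ifs with hb
    · rw [code_insert_of_notMem hv.1, h]
      simp; omega
    · rw [h]
      simp [hx]; omega

lemma Good.sum_nonneg {F : Finset (Finset ℕ)} (hF : UC F) {v : List ℕ} (hv : v.Nodup)
    {E : List ℕ} {φ : ℕ → ℤ} (h : Good (2 ^ v.length) E φ)
    (hE : ∀ e ∈ E, e < 2 ^ v.length ∧ select v e ∈ F) : 0 ≤ ∑ A ∈ F, φ (code v A) := by
  classical
  rw [← Finset.sum_fiberwise_of_maps_to (t := F.image (· \ v.toFinset))
    (fun A hA => Finset.mem_image_of_mem _ hA)]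
  refine Finset.sum_nonneg fun C _ => ?_
  have key := h (fun S => S ∈ (F.filter (· \ v.toFinset = C)).image (code v))
    (fun S hS => by
      obtain ⟨A, -, rfl⟩ := Finset.mem_image.1 hS
      exact code_lt v A)
    (fun S T hS hT => by
      obtain ⟨A, hA, rfl⟩ := Finset.mem_image.1 hS
      obtain ⟨B, hB, rfl⟩ := Finset.mem_image.1 hT
      rw [Finset.mem_filter] at hA hB
      rw [← code_union]
      refine Finset.mem_image_of_mem _ (Finset.mem_filter.2 ⟨hF _ hA.1 _ hB.1, ?_⟩)
      rw [Finset.union_sdiff_distrib, hA.2, hB.2, Finset.union_self])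
    (fun e he S hS => by
      obtain ⟨A, hA, rfl⟩ := Finset.mem_image.1 hS
      rw [Finset.mem_filter] at hA
      obtain ⟨hlt, hmem⟩ := hE e he
      rw [← code_select hv hlt, ← code_union]
      refine Finset.mem_image_of_mem _ (Finset.mem_filter.2 ⟨hF _ hA.1 _ hmem, ?_⟩)
      rw [Finset.union_sdiff_distrib, hA.2, Finset.sdiff_eq_empty_iff_subset.2 (select_subset v e),
        Finset.union_empty])
  rw [← Finset.sum_filter, Finset.filter_mem_eq_inter, Finset.inter_eq_right.2, Finset.sum_image]
    at key
  · exact key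
  · intro A hA B hB hAB
    simp only [Finset.coe_filter, Set.mem_ofPred_eq] at hA hB
    ext x
    by_cases hx : x ∈ v
    · exact mem_iff_of_code_eq hAB hx
    · have := congrArg (x ∈ ·) (hA.2.trans hB.2.symm)
      simpa [hx] using this
  · intro S hS
    obtain ⟨A, -, rfl⟩ := Finset.mem_image.1 hS
    exact Finset.mem_range.2 (code_lt v A)

/-- The number of members of `F` containing `i` minus the number of members avoiding `i`. -/
def excess (F : Finset (Finset ℕ)) (i : ℕ) : ℤ := ∑ A ∈ F, if i ∈ A then 1 else -1

lemma sum_lin_cons (F : Finset (Finset ℕ)) (w : ℤ) (l : List ℤ) (x : ℕ) (v : List ℕ) :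
    ∑ A ∈ F, lin (w :: l) (code (x :: v) A) = w * excess F x + ∑ A ∈ F, lin l (code v A) := by
  rw [excess, Finset.mul_sum, ← Finset.sum_add_distrib]
  refine Finset.sum_congr rfl fun A _ => ?_
  rw [lin, code, Nat.bit_div_two, Nat.bit_mod_two]
  by_cases hx : x ∈ A <;> simp [hx]

lemma sum_lin_neg {F : Finset (Finset ℕ)} {l : List ℤ} {v : List ℕ} (hl : ∀ w ∈ l, 0 < w)
    (hv : ∀ x ∈ v, excess F x < 0) (hlen : l.length ≤ v.length) (h0 : l ≠ []) :
    ∑ A ∈ F, lin l (code v A) < 0 := by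
  induction l generalizing v with
  | nil => exact absurd rfl h0
  | cons w l ih =>
    cases v with
    | nil => simp at hlen
    | cons x v =>
      rw [sum_lin_cons]
      have h1 := mul_neg_of_pos_of_neg (hl w (by simp)) (hv x (by simp))
      by_cases hl0 : l = []
      · subst hl0
        simpa [lin] using h1
      · have := ih (v := v) (fun w hw => hl w (by simp [hw])) (fun x hx => hv x (by simp [hx]))
          (by simpa using hlen) hl0
        linarith

lemma Good.false_of_lin {F : Finset (Finset ℕ)} (hF : UC F) {v : List ℕ} (hv : v.Nodup)
    {E : List ℕ} {l : List ℤ} (h : Good (2 ^ v.length) E (lin l))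
    (hE : ∀ e ∈ E, e < 2 ^ v.length ∧ select v e ∈ F) (hneg : ∀ x ∈ v, excess F x < 0)
    (hl : ∀ w ∈ l, 0 < w) (hlen : l.length ≤ v.length) (h0 : l ≠ []) : False :=
  (h.sum_nonneg hF hv hE).not_gt (sum_lin_neg hl hneg hlen h0)

section Certificates

set_option maxRecDepth 100000

lemma good_triangle : Good 16 [7, 11, 13] (lin [3, 2, 2, 2]) :=
  Packed.good_of_check
    (.br 218279953 2
    (.br 2 4
    (.br 73737 1
    (.leaf 41)
    (.leaf 0))
    (.leaf 25))
    (.br 204841 6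
    (.leaf 36885)
    (.leaf 83922997)))
    (by decide) (by decide +kernel)

lemma good_relaxed_star :
    Good 32 [7, 11, 19]
      (twin 0 1 (lin [3, 3, 2, 2, 2])) :=
  Packed.good_of_check
    (.br 1581185 1
    (.br 1677893645 5
    (.br 0 9
    (.leaf 147473)
    (.leaf 41))
    (.leaf 5))
    (.br 11552455499945 4
    (.br 9901040549961 5
    (.leaf 25)
    (.leaf 0))
    (.br 45081117933609 5
    (.leaf 25)
    (.leaf 25))))
    (by decide) (by decide +kernel)

lemma good_star : Good (2 ^ 5) [7, 11, 19] (lin [3, 3, 2, 2, 2]) := by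
  have h0 := good_relaxed_star
  have h1 := Good.of_twin (n := 5) h0 (by decide) (by decide) (by decide) (by decide +kernel)
  exact h1

lemma good_path : Good 32 [7, 13, 25] (lin [4, 2, 3, 3, 2]) :=
  Packed.good_of_check
    (.br 5436874849 1
    (.br 85683848352014347 6
    (.br 4949482037379 16
    (.leaf 893001)
    (.leaf 0))
    (.br 942289 2
    (.leaf 69)
    (.leaf 0)))
    (.br 5202797072138808729667 4
    (.br 1677869067 8
    (.leaf 294931)
    (.leaf 0))
    (.br 9897282461715 8
    (.leaf 1409343492)
    (.leaf 1409343492))))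
    (by decide) (by decide +kernel)

lemma good_relaxed_cherry :
    Good 64 [7, 11, 49]
      (twin 4 5 (lin [10, 8, 5, 5, 5, 5])) :=
  Packed.good_of_check
    (.br 853276058992769 20
    (.br 77014010201691899849876097286737 28
    (.br 133458230513636822368729 18
    (.br 306966865187702132736241 9
    (.leaf 125093101714)
    (.leaf 402))
    (.br 155704393794 52
    (.br 17710532559031794516675 9
    (.leaf 2179218)
    (.leaf 0))
    (.br 19873710449 56
    (.leaf 71)
    (.leaf 0))))
    (.leaf 2622173941096246761710868550896468185))
    (.br 62120353756703225713704927789401 18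
    (.br 163849894744857327066892269027907 4
    (.leaf 147601)
    (.leaf 0))
    (.br 103620755651 48
    (.br 1082222909898916177 4
    (.br 2224586434995110905161760913 6
    (.leaf 147513)
    (.leaf 0))
    (.leaf 88589090823))
    (.br 321075112165649 4
    (.br 142859873055579258798161 14
    (.leaf 15305195573)
    (.leaf 4079691))
    (.leaf 4509125675969717936738268941861968036107)))))
    (by decide) (by decide +kernel)

lemma good_cherry : Good (2 ^ 6) [7, 11, 49] (lin [10, 8, 5, 5, 5, 5]) := by
  have h0 := good_relaxed_cherry
  have h1 := Good.of_twin (n := 6) h0 (by decide) (by decide) (by decide) (by decide +kernel)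
  exact h1

lemma good_relaxed_matching :
    Good 128 [7, 25, 97]
      (twin 1 2 (twin 3 4 (twin 5 6 (lin [2, 1, 1, 1, 1, 1, 1])))) :=
  Packed.good_of_check
    (.br 29314348943604882556705063794288797584294283 42
    (.br 992863009031584944541795451650 46
    (.br 3178521 58
    (.leaf 3440867)
    (.leaf 31228827))
    (.br 866535310087 24
    (.leaf 97)
    (.leaf 0)))
    (.br 675935850979212473595209024002 14
    (.br 12420419459187079 98
    (.leaf 1212263793049)
    (.br 539 24
    (.leaf 105)
    (.leaf 617)))
    (.br 105 26
    (.br 12421106632983065 6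
    (.leaf 99)
    (.leaf 483))
    (.br 227 6
    (.br 1868455 24
    (.leaf 97)
    (.leaf 353))
    (.br 3178649 38
    (.leaf 313)
    (.leaf 569))))))
    (by decide) (by decide +kernel)

lemma good_matching : Good (2 ^ 7) [7, 25, 97] (lin [2, 1, 1, 1, 1, 1, 1]) := by
  have h0 := good_relaxed_matching
  have h1 := Good.of_twin (n := 7) h0 (by decide) (by decide) (by decide) (by decide +kernel)
  have h2 := Good.of_twin (n := 7) h1 (by decide) (by decide) (by decide) (by decide +kernel)
  have h3 := Good.of_twin (n := 7) h2 (by decide) (by decide) (by decide) (by decide +kernel)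
  exact h3

lemma good_relaxed_kite :
    Good 32 [7, 11, 28]
      (twin 0 1 (lin [2, 2, 2, 2, 1])) :=
  Packed.good_of_check
    (.br 220699480411873345 1
    (.br 1660463700961624727761 5
    (.br 9 3
    (.leaf 18)
    (.leaf 0))
    (.leaf 37))
    (.br 3930411411314622318288946 3
    (.leaf 1142038705)
    (.leaf 9353433325577)))
    (by decide) (by decide +kernel)

lemma good_kite : Good (2 ^ 5) [7, 11, 28] (lin [2, 2, 2, 2, 1]) := by
  have h0 := good_relaxed_kite
  have h1 := Good.of_twin (n := 5) h0 (by decide) (by decide) (by decide) (by decide +kernel)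
  exact h1

lemma good_looseTriangle : Good 64 [7, 28, 49] (lin [3, 2, 3, 2, 3, 2]) :=
  Packed.good_of_check
    (.br 25870387195006861441 1
    (.br 10950661474423594593363101007599913781247777591541130620059972 9
    (.br 13482756576350631088764305442 6
    (.br 3172316992641757740255428721 16
    (.br 293 40
    (.leaf 4243533)
    (.leaf 613))
    (.leaf 293))
    (.br 118062116578276523131523 2
    (.br 325 40
    (.leaf 3424461)
    (.leaf 0))
    (.br 0 4
    (.leaf 241)
    (.leaf 0))))
    (.br 10293951900155310008805761594731067490377 6
    (.br 30870618193 4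
    (.leaf 2900273)
    (.leaf 113))
    (.br 499 2
    (.leaf 197)
    (.leaf 0))))
    (.br 1293017877345087650258313480315650371 4
    (.br 160295624116423003598103559184071787390845457 36
    (.br 2804876730936207592013332489 40
    (.leaf 15780630705554391138)
    (.br 8831147 42
    (.leaf 260)
    (.leaf 0)))
    (.leaf 7712564018405851233))
    (.br 69409112535224273550774943138217 16
    (.br 695551620511438428708708815180737630679695705 8
    (.leaf 1002772601405572)
    (.leaf 458))
    (.br 8592316769528755714559356087254330228833 3
    (.leaf 9652717797469852318341709913)
    (.br 22012903705 42
    (.leaf 65233649868)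
    (.leaf 99596533964))))))
    (by decide) (by decide +kernel)

lemma good_relaxed_disjointFork :
    Good 256 [7, 11, 52, 200]
      (twin 0 1 (twin 4 5 (twin 6 7 (lin [2, 2, 2, 2, 1, 1, 1, 1])))) :=
  Packed.good_of_check
    (.br 5850391130656689112308534838036851111612974566174559165991988514326609 81
    (.br 90380583338516794118352786284826700113455676292619383464346945722171931670304272352107994613333 85
    (.br 70929245581675967616325 65
    (.br 72156173 83
    (.br 67836298319234826 5
    (.leaf 18416409)
    (.leaf 1817))
    (.br 439401422469206276 9
    (.leaf 1301)
    (.leaf 0)))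
    (.br 373555481 9
    (.leaf 1301)
    (.leaf 0)))
    (.br 58808829806240149418380818196148256444837595717 83
    (.leaf 1035099766834)
    (.leaf 11287343139332)))
    (.br 13650732965729577894847193911427402325 17
    (.br 4829539859628157857019149975008967552774583504654044982315821318681528270981661185884847725958203458 19
    (.leaf 1035099768085)
    (.leaf 68487172))
    (.br 415749625993102853 65
    (.br 261808516389775334926266928039547494645333090343297187221216434431626087135510897 67
    (.leaf 15794226)
    (.leaf 2052))
    (.br 669076160129401097 1
    (.br 403575666691209560840247007184144872507490482757283757903144357233 3
    (.leaf 241)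
    (.leaf 0))
    (.br 2931684312493643495747749909 19
    (.leaf 33920464169902844962748886373864925493596326725)
    (.br 22819037040911992031601 3
    (.leaf 4445697135329897874189)
    (.br 3234198784013 67
    (.leaf 1393)
    (.leaf 1393))))))))
    (by decide) (by decide +kernel)

lemma good_disjointFork : Good (2 ^ 8) [7, 11, 52, 200] (lin [2, 2, 2, 2, 1, 1, 1, 1]) := by
  have h0 := good_relaxed_disjointFork
  have h1 := Good.of_twin (n := 8) h0 (by decide) (by decide) (by decide) (by decide +kernel)
  have h2 := Good.of_twin (n := 8) h1 (by decide) (by decide) (by decide) (by decide +kernel)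
  have h3 := Good.of_twin (n := 8) h2 (by decide) (by decide) (by decide) (by decide +kernel)
  exact h3

lemma good_relaxed_meetingFork :
    Good 128 [7, 11, 52, 104]
      (twin 0 1 (lin [2, 2, 2, 2, 1, 1, 1])) :=
  Packed.good_of_check
    (.br 6525552767970764757435332643844101110061138969604047989908471370776961 17
    (.br 45085732708199357468317155425297866104839149751697474 25
    (.br 235279440240499876230691770135898031497 1
    (.br 253784244072739236417547337765 5
    (.br 1392690481689387417852763505065 96
    (.br 1312121553412 28
    (.leaf 233046835716)
    (.leaf 36471044))
    (.leaf 90374233))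
    (.br 4099842117425406452474714710638725 96
    (.br 296373847317 20
    (.leaf 2163332)
    (.leaf 260))
    (.leaf 73466261)))
    (.br 10298471299288001452959272984231994913103215786341657911396102 33
    (.br 1084913948976489857933 4
    (.leaf 714)
    (.leaf 0))
    (.leaf 0)))
    (.br 64952189724012727459153621450189402155202612671915547058982940250108382591386780283569935875376009 21
    (.br 85319322828407081093 97
    (.leaf 9148233116942981)
    (.leaf 0))
    (.leaf 490063839990637036421)))
    (.br 1590774938449585758558707417994 1
    (.br 38098035605914442832676478131301727382103644976145012614247104963924707817290557900117408610955189010018854661377194408870289 5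
    (.br 29027272336113833 3
    (.leaf 112988032500422443121)
    (.br 881 48
    (.leaf 14811556)
    (.leaf 0)))
    (.br 8057372626420101 68
    (.leaf 713)
    (.leaf 0)))
    (.br 58758147423121007856893921677069431447027717 65
    (.br 60488706814129699997590155442090214356417834072239715900471204934433148261926449833347089 8
    (.leaf 789585809617367922639531952846595064274)
    (.br 917321767883531528603911653382 24
    (.leaf 1174)
    (.leaf 1814)))
    (.br 1502942390495761701101643953152572174534694961670 16
    (.br 953085193706657892583361342595489103985 96
    (.br 296369653474 21
    (.leaf 15270660)
    (.leaf 8521426))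
    (.leaf 75506098471306322))
    (.br 15575251509409991520232267626327494707081863769391813 3
    (.leaf 1149789396625299137304205079357840457913)
    (.br 78385021041 48
    (.leaf 485345068257)
    (.leaf 849715569738829136569)))))))
    (by decide) (by decide +kernel)

lemma good_meetingFork : Good (2 ^ 7) [7, 11, 52, 104] (lin [2, 2, 2, 2, 1, 1, 1]) := by
  have h0 := good_relaxed_meetingFork
  have h1 := Good.of_twin (n := 7) h0 (by decide) (by decide) (by decide) (by decide +kernel)
  exact h1

lemma good_relaxed_doubleFork :
    Good 64 [7, 11, 52, 56]
      (twin 0 1 (twin 4 5 (lin [2, 2, 2, 2, 1, 1]))) :=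
  Packed.good_of_check
    (.br 67311376988510322180353 5
    (.br 12418247774114098623345410706 16
    (.br 55032561866 3
    (.leaf 49)
    (.leaf 0))
    (.br 594 3
    (.leaf 49)
    (.leaf 0)))
    (.br 39198278097 4
    (.br 615088955290894962294786 3
    (.leaf 49)
    (.leaf 0))
    (.br 194 9
    (.br 620314075939410 3
    (.leaf 49)
    (.leaf 0))
    (.br 2269405159702610 1
    (.leaf 3358921)
    (.leaf 105501639113)))))
    (by decide) (by decide +kernel)

lemma good_doubleFork : Good (2 ^ 6) [7, 11, 52, 56] (lin [2, 2, 2, 2, 1, 1]) := by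
  have h0 := good_relaxed_doubleFork
  have h1 := Good.of_twin (n := 6) h0 (by decide) (by decide) (by decide) (by decide +kernel)
  have h2 := Good.of_twin (n := 6) h1 (by decide) (by decide) (by decide) (by decide +kernel)
  exact h2

lemma good_relaxed_tripod :
    Good 512 [7, 25, 98, 388]
      (twin 3 4 (twin 5 6 (twin 7 8 (lin [2, 2, 2, 1, 1, 1, 1, 1, 1])))) :=
  Packed.good_of_check
    (.br 1292599635875891135934033369193070273264186342565570644889125432249909416292923255622984185529725678255495618928388884199590284455048606265915873953 168
    (.br 486291826141632490487100814572984309207312503246910878719807991486082045066946217047405729331947975767094480212980405109310162572233239854189014481531831645561313715146332889903463133643927157636058068521 169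
    (.br 58533810197603142914709520609 170
    (.br 76482429303233170496600278441 172
    (.br 11647180872758153971061794089862377 10
    (.br 4686210833407740257448073279023460254725 33
    (.leaf 95159996519533)
    (.leaf 0))
    (.br 649107143097168310080319914045 12
    (.leaf 55439854406715)
    (.leaf 0)))
    (.br 23937127025228195955221434438685864656171496983379665033746852005 384
    (.leaf 742921740)
    (.leaf 0)))
    (.br 1435367220597624104427846241411385043410168044558271433558017124549588112491041836187918499 172
    (.br 526841555279363919971049 96
    (.leaf 755766798)
    (.leaf 0))
    (.leaf 1075454117)))
    (.br 35823769950831120277104925083900055398154871712236333030757857997615628950585211954093539712418851088190228905859618 170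
    (.br 3298902137411601413 172
    (.br 4019465296027976889 24
    (.leaf 755897895)
    (.leaf 0))
    (.leaf 1075454117))
    (.leaf 259002242443884573198286985891)))
    (.br 15876176275723364526390186809367085 40
    (.br 6514946435788644575045131099491856582399418868396998851195593190561792829800593600831322622291255542646570465818021997369522654600635904341882199608955421002256438261316521813970147192541997973727787956726442346093331387669556396063356570703497 424
    (.br 4036222252839264474385102194597105501700 41
    (.br 58531989147710076998296666217 42
    (.br 53824671842361 1
    (.leaf 189138315)
    (.leaf 0))
    (.leaf 68771537889315))
    (.br 169145192772058491395586 56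
    (.leaf 27127354098219)
    (.leaf 7705)))
    (.br 2104610501174409831004432141025701312284354877965317543434113 41
    (.br 148504681 56
    (.leaf 206438947)
    (.leaf 0))
    (.leaf 5666)))
    (.br 538357339877180006921087914911083909795417130 8
    (.br 1478483411844900566909479763062536597760743940721915588464751624751577355989324572715635103764215947205432453994832263637360584512021825422320297922816773665 232
    (.br 25964813915715767214229514973487035059032875600386 137
    (.br 5712884486305876873 12
    (.br 2866614194995987097 5
    (.leaf 1249)
    (.leaf 0))
    (.br 269233669 100
    (.leaf 665)
    (.leaf 0)))
    (.br 470556290 12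
    (.leaf 2866587806515593881)
    (.leaf 7685)))
    (.br 6971139535319610842701242241652851216097 9
    (.br 131801831752022586973553615832640456761675801 12
    (.leaf 21475058123417)
    (.leaf 5125))
    (.br 1504372840390688749784578 104
    (.br 64605302167203689982330540569 3
    (.leaf 905)
    (.leaf 0))
    (.br 1091309153 24
    (.leaf 422708365)
    (.leaf 1092225689)))))
    (.br 32294789636303160363740851356177549 136
    (.br 13491630540579771392794202234572739664102799233734878393919263257940113297813613720881594137903183824899958552077222340130405692113115506502199837780307482145 232
    (.br 492915667029710787576965 137
    (.br 1005591656050323707365882921749037067938 100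
    (.leaf 3594)
    (.leaf 0))
    (.leaf 362794379483596340478370651658))
    (.br 81581648332886837815533174682951149297014781646433 24
    (.leaf 17434147)
    (.leaf 0)))
    (.br 546895081596000557269323561294515869441987722 9
    (.br 3523000588442107680216454153219411737393438845746740161403030437559115418542296815448923051251201594284438503019538981798702790010597148795947195571477803057664955298464269729954 34
    (.leaf 661783195)
    (.leaf 441))
    (.br 1101180875419818669 184
    (.br 10600978100405926491123927649760756725407672015267925652578545433915017192583965751205036037 186
    (.br 432410494921460769489825 188
    (.br 6633832917279965921 161
    (.br 390466277 2
    (.leaf 221906493)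
    (.leaf 0))
    (.leaf 0))
    (.br 274797050550441265993893 385
    (.leaf 3235)
    (.leaf 0)))
    (.br 25490105393767061607605138278978211 164
    (.leaf 65851005079265)
    (.leaf 0)))
    (.br 22117407813127785101546000112984289058720836095200913234088267151185570 56
    (.br 19566222398122117076721537572371359072981735020577157773533515417 34
    (.leaf 33965058821025)
    (.br 6049 3
    (.leaf 1953)
    (.leaf 0)))
    (.br 688787460 132
    (.br 128475938101536820212738950681 34
    (.leaf 11369423605742044065)
    (.br 189007265 2
    (.leaf 259130521)
    (.leaf 0)))
    (.br 633602563 152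
    (.br 83018626613197434392130780514537605478092321 5
    (.leaf 32643619)
    (.leaf 4643))
    (.br 3474536012322048517 34
    (.leaf 135903635008006834866373133849)
    (.br 189007265 24
    (.leaf 5604830771291489825)
    (.leaf 4451838898343117857))))))))))))
    (by decide) (by decide +kernel)

lemma good_tripod : Good (2 ^ 9) [7, 25, 98, 388] (lin [2, 2, 2, 1, 1, 1, 1, 1, 1]) := by
  have h0 := good_relaxed_tripod
  have h1 := Good.of_twin (n := 9) h0 (by decide) (by decide) (by decide) (by decide +kernel)
  have h2 := Good.of_twin (n := 9) h1 (by decide) (by decide) (by decide) (by decide +kernel)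
  have h3 := Good.of_twin (n := 9) h2 (by decide) (by decide) (by decide) (by decide +kernel)
  exact h3

lemma good_relaxed_shortChain :
    Good 128 [7, 11, 56, 112]
      (twin 0 1 (twin 4 5 (lin [3, 3, 2, 4, 3, 3, 2]))) :=
  Packed.good_of_check
    (.br 298389527923229368032900088065 17
    (.br 1625895838330442655541350039919107643601241882233091954355076731908218624735235342997 25
    (.br 1361601072239212625989 8
    (.br 2785350 3
    (.leaf 53706654278)
    (.leaf 6979782))
    (.leaf 2785350))
    (.br 30110403640730605211419401 3
    (.leaf 50)
    (.leaf 0)))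
    (.br 50342065975328069437572146694226114 1
    (.br 706489611501169335594134811499573195549348087464374862225 20
    (.leaf 26974384482479107096052425)
    (.br 74092839044 3
    (.leaf 178)
    (.leaf 0)))
    (.br 46901469188227222 20
    (.br 63699110729125085606855499042969372577621566896112785 3
    (.leaf 224426852529)
    (.leaf 6849860))
    (.br 48129810492564823176560518559513078824993874 4
    (.br 16116122856325521 3
    (.leaf 177)
    (.leaf 945))
    (.br 17302807304544070750733329 28
    (.leaf 19038277)
    (.leaf 6455365))))))
    (by decide) (by decide +kernel)

lemma good_shortChain : Good (2 ^ 7) [7, 11, 56, 112] (lin [3, 3, 2, 4, 3, 3, 2]) := by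
  have h0 := good_relaxed_shortChain
  have h1 := Good.of_twin (n := 7) h0 (by decide) (by decide) (by decide) (by decide +kernel)
  have h2 := Good.of_twin (n := 7) h1 (by decide) (by decide) (by decide) (by decide +kernel)
  exact h2

lemma good_relaxed_longChain :
    Good 512 [7, 11, 56, 224, 448]
      (twin 0 1 (twin 6 7 (lin [2, 2, 1, 3, 2, 3, 2, 2, 1]))) :=
  Packed.good_of_check
    (.br 5433575652913866946611519678848376039147042153110830083769947905489472274006058595405520580223217063575377499126259313116270245798577562225763284519329157627898781671983415033516910290210165729414278776716873486975780391425 65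
    (.br 203222466302804219765913722686227476469716222374330723376676937011303777117441561534380066300634292536866445600121937822427577902566918273780742558981408703512185952439006339697111054336032089634603540734712885169235666893164134841886618670506182466 81
    (.br 5953998012700921724898506469706506677626698142333990625008327136628227077708075560791711318 101
    (.br 7661118547076165115959925358452268095801296545384320342907228664705283093070386226710696111694609327109462769942763164257616458 33
    (.br 33895611928401647249020260216229298097692237447545729521102830991314180 89
    (.br 51088687608190075092149456552483152619062276540808822790 76
    (.leaf 5689777093111722849344304698964132371301)
    (.leaf 586881604134245))
    (.leaf 170504437756879500876461743115621736942901935638218978508361))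
    (.br 519365366256089226524162024579616381175734852 72
    (.br 3497580460588846414339696612140861669629977884091486406 289
    (.leaf 1304561244113282299202836)
    (.leaf 5091393133443950868))
    (.br 4453 353
    (.br 230645442583742092134848927498 24
    (.leaf 1734)
    (.leaf 0))
    (.br 6494687816109410082 96
    (.leaf 1896047397780849428)
    (.leaf 0)))))
    (.br 127426280983872872215600150673626196817558227349992014431401700523628588587991932841229329777692388902 69
    (.br 24702235687252017166256839127110401510674238215991483624596459601365321057038920803280554685785327274169378 113
    (.br 1132547693543867024299334032182302159416067140 293
    (.leaf 3658)
    (.leaf 290))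
    (.br 130219201814754184402032536626 209
    (.br 271713866 92
    (.leaf 3777)
    (.leaf 0))
    (.leaf 1501703362)))
    (.leaf 26406855453955425731124373875364740138582224388040772940045312123810130787741219621996749405923231093423477628538447538991803981609009210882587236624279285317)))
    (.br 517186214930796924120683068320693533824796596695208960466781324620590101387376174957742536064738821927910286655122755364063892793476626886098413341602031148740266609191773686701198778878579908568660943523570247727715858 341
    (.br 8925064616521679465942423302307288267217102327426112707040658197309725789013061680140387850 101
    (.br 1553889964659530640032106783946419998794 289
    (.leaf 937691985726362419993101)
    (.leaf 0))
    (.leaf 35220820730174767906955751068412966))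
    (.br 552238226022667513650869208231481130284076738449905430 73
    (.br 1152453866429651966369572581700897867302 97
    (.br 91762838158197300370691327813 12
    (.leaf 40413012051739554925920092250447138)
    (.leaf 248119586))
    (.leaf 558719096423484038979106))
    (.br 1571045868811321176490019112525531433582042104767630323881482 12
    (.leaf 3106)
    (.leaf 0)))))
    (.br 4765669079926383428465226711739546677711732221327261201674606259076668202018 81
    (.br 39136042956244320444613250913797278653787163465174744829018418142689392347383137176979671967512224809072195910453043253199353534931178860270621549363619944777043923018450843103270797390433656937703644399828160189257584227739905627345319633705052448365278355255043390368692695754108534551171615539358829336484189149833508001126833465716182470146562177238786 327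
    (.br 337560241540587692014442851345386360248863790928462840827211946309 73
    (.leaf 31686400782860491362397447147145635619196257635820550956131641721904455560517917179475384514945327036504117524475911213353502176596517091859789747560451864597339300030056518)
    (.br 503416688717256038620454977573 69
    (.br 21719675142755154839027278896528081513412063062407877868329118538536710 77
    (.br 522223640096353659635568416726119299965074363069705075950278 41
    (.leaf 4418)
    (.leaf 0))
    (.leaf 2484199285633924623906582194144132204007135309))
    (.br 249608876918693277008089801501438192901007970278477 325
    (.leaf 44360158529860436188146252865731844629070018118153)
    (.br 1297789579775112342417965 261
    (.leaf 5954)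
    (.leaf 12813)))))
    (.leaf 1795744156064864403401983053093631330792318068865553568920510120384398550446210016939890896220826024625246732914152833758624272165217215530778729954402514546490459382029929979290866852286976322))
    (.br 9279411373880732508618524134746438 17
    (.br 55706290619566219345767976386872289159428215138811908287174222988226086231293406156915688299919557810778316373450165927096644481434733405977510211746038221971182524489285512733671777130384327684438447206686930874935387068689379101049978807644735887233240494574884431604913128053675854370809351270617026648904434954641119907038322247242271095397441 69
    (.leaf 1022549456028604868705412730930653612766685041842853978799989100541358763154833121797835027553338575450510625177412169808019301335017982248154475969501070114)
    (.br 108756434918160674473831990070738142336550619971697 261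
    (.br 106356055668816230807362411190361597337024009873316566908902732801288709770709582 25
    (.br 228853445 8
    (.leaf 1574035753449334097313798)
    (.leaf 1734))
    (.leaf 1815229961))
    (.br 516472622543231247208025881191486596174 257
    (.leaf 14507122717869132412096244863342598)
    (.br 7686 289
    (.leaf 4136587267483636269)
    (.leaf 9314)))))
    (.br 131821641288668310034687631790076429717192515528966 80
    (.br 88623524626461360596965465779041599185035339924045113195077852925968906645222597456523157052757320386011688312451153107474326154433562230238052683574589429133113384261925383977096420897509628510043784097868469573221980199296792153095204231541420667488832432678696454284623257803693058 321
    (.leaf 46358048905669569666354993727973979453042235283904598991364670148875336816158887009518707931831904684606564036781438082466303401326697225139147545405293556597734378061)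
    (.br 12439667215878055458464974142964175079693 324
    (.br 450704508793259206868485489005731814189384248710531682 112
    (.br 8214437947884610356972987028604422 32
    (.leaf 61611902648097045824567246954588470245669070852105)
    (.leaf 11444740060387883838867052439446110743873))
    (.leaf 47571240796765511248106243474612546547286672901682806237887957116794401))
    (.br 431905523382826620118622341316665955555365557679791236214072291843232277648127521 68
    (.leaf 114934347372537385114028357675094248298181160474945)
    (.br 309524378131039073350850318434 76
    (.leaf 642910546)
    (.leaf 0)))))
    (.br 3589614120085373624376368351053964127857 69
    (.br 522642251352695992291986871682793767395002611236947422320820347407813047451239973353201183769267230983026077290274652352948315066994726725021037190413944675790153756750652175702103861020721126291553964666659946856300568578697465364955109373607152513615218588871337974329382373528633311028958781833614736706 333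
    (.br 22381806000102700164976622461142765355831681081711822490104974125250526216200007972450783838018069915256906 279
    (.br 9244222969865928987136453957814032404757 273
    (.leaf 111481019697924)
    (.leaf 225831436965124))
    (.leaf 2274276003924347696219065808442451018198477028899232896667410))
    (.leaf 844967249010610866079493345641524032698208890047496772719002247236788538718554037198412720754589760746951877162547671608410731563745871811946631210138327745756283409225))
    (.br 5314638304323137365809885180464837402208318576443035550850814711703626 1
    (.br 310961575782957101599908998215949644636947106118231495401642619543783249374907412463938667569408823356195141052201917202234183282241171601247036203172301516450365138771245139873712774097591615271015771544579376051370938172179696673875505409734250248932417 9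
    (.br 2919293083957504976193924201233805645284943940938512242134625048776407662413 20
    (.leaf 208990741026435997778969)
    (.leaf 86478779860683288881426))
    (.br 23997822622870625457090916594017721841641366975018167775116150222097417 24
    (.leaf 405408453)
    (.leaf 8213)))
    (.br 3259922468087689646449162 321
    (.leaf 188586685678582384007843996070944964781886426868183958781321591031255231558278730190748306264441339687205879254825162601062311462981522976491461130660722760525879456544811040364061873868273055977105250901648704779429812568928995910265224214455965811870102507269562617415498680390783868254706458506336256835179553541995073)
    (.br 359507656095372635260410669389 71
    (.br 259300687022227603132872927537008759586009466276329502077191102435328247374325028944911985457993364064508967590622556840624343023432600248100983302 257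
    (.leaf 190628173248745379128641611240659174240391113286700695079587215349128096695342685337842808008338996050246448622904686364146047145668803405233133633)
    (.br 10290 16
    (.leaf 46823819839173168190230866180534687647033653497358447559638555890641481214392392959655260896524983509779909134910178335297)
    (.br 662316963706084916340289 320
    (.br 2640117646562018669188788508397110617106177201131500741061701726498632378197 67
    (.leaf 57604510436923428010366078001)
    (.leaf 379716426))
    (.br 218920565780245302149512344288379216283833924 324
    (.leaf 5012083054996763521366359706371511316390394686660028757)
    (.leaf 4325692602104266739596712867399217)))))
    (.br 454021546887426317004002175259244040431946650800383083242003770000704524600277444244986467818387599884272996683737636584308258726023002730049 257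
    (.br 37594505890564672842595557785385463515657691484817258975254843040348870802770135151924174581354800932882437588128577 5
    (.leaf 128899379514001650890900785522447073074205369187857)
    (.br 5641988835970970711535899362999843564561 196
    (.leaf 66675746672329)
    (.leaf 1412575945)))
    (.br 299394697384558505323109829258309113774112104202048352364635439250386805774689672818199558 16
    (.leaf 21706279373550229564362361797660111245316499860611366981665740944835269)
    (.br 284881179413630440451456769060 23
    (.br 14882263870547296453 48
    (.leaf 4116452942533492996)
    (.leaf 8728086184469863684))
    (.leaf 441921160900686679604422673698333616864112149))))))))))))
    (by decide) (by decide +kernel)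

lemma good_longChain : Good (2 ^ 9) [7, 11, 56, 224, 448] (lin [2, 2, 1, 3, 2, 3, 2, 2, 1]) := by
  have h0 := good_relaxed_longChain
  have h1 := Good.of_twin (n := 9) h0 (by decide) (by decide) (by decide) (by decide +kernel)
  have h2 := Good.of_twin (n := 9) h1 (by decide) (by decide) (by decide) (by decide +kernel)
  exact h2

lemma good_link : Good 128 [7, 28, 112] linkPotential :=
  Packed.good_of_check
    (.br 10060373526606019903213860509975169 18
    (.br 13614616337200709745419746814527690374411662363052298172281682724115723714886132480115970 8
    (.br 174438717678656145804792348258489208909562001155917395140282898403599535903017362723887589338195908287517526979424950667449103951398818 104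
    (.br 255933069212927304106773171510021457724079954025845655746 4
    (.br 1302201717016876033704200517433530964241284035519674446723217539933239053222 35
    (.leaf 52024782832671501389533026)
    (.leaf 1570297738419853461986))
    (.br 1199642743086885308486679396549 16
    (.br 3068083853837425900426638222128792874926112269458853792178 97
    (.leaf 31631787773067779)
    (.leaf 23265958))
    (.br 21231985700074309601003234 48
    (.br 32828022034989106 69
    (.leaf 40928402)
    (.leaf 0))
    (.br 68323493 37
    (.leaf 1202)
    (.leaf 2226)))))
    (.br 74276490324081339431485789450601057 36
    (.br 72740756615472316978227727897232907323757365827957337515537142795272358 4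
    (.leaf 10313964365019003140342098)
    (.leaf 3647549801413))
    (.br 10767315530713033 4
    (.leaf 144799085399948786122710632619015511038571641328205528310494171544272837809572390)
    (.br 93436816902015092658 68
    (.leaf 67165324428499327658828835309919976285078441)
    (.br 4716811489937362 10
    (.br 98 37
    (.br 1204757398545 98
    (.leaf 15)
    (.leaf 0))
    (.br 0 16
    (.leaf 4391110)
    (.br 0 98
    (.leaf 271)
    (.leaf 0))))
    (.leaf 515))))))
    (.br 38661227793 40
    (.br 438938813106961282544973463584915002050209974797298225377257312659747620278805321632200274018999534386225801413253990722 36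
    (.br 1423522639184897674745803575827484087812836539099499294647509386278 17
    (.leaf 80721147603542279750)
    (.br 44960699040925695178509446 67
    (.leaf 4557126)
    (.leaf 1094)))
    (.br 967517044914 17
    (.br 56187542746464702995879353215446534633096486 97
    (.leaf 21987861784326517861843075)
    (.leaf 77793604))
    (.br 93869271973301512697977515536416994 37
    (.br 2636844965352383033268729217841 67
    (.leaf 38109323)
    (.leaf 0))
    (.br 42926656261917010 96
    (.leaf 5031510178726055)
    (.leaf 0)))))
    (.br 619124724386804073733 72
    (.br 168430775461779419612287796165754640311136363417482508226110717666509461873858954332760701175113145495617730 68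
    (.br 1641168123033572117452900104663290011180085477379451290680501919987409257134799490226 33
    (.leaf 74452342203842955)
    (.leaf 0))
    (.br 2864652906561911604709434755362 96
    (.br 186987741503980266383219168752644562476890980550 49
    (.leaf 4555942)
    (.leaf 176149367590))
    (.br 1230200038253244123442 17
    (.leaf 1415233865030)
    (.leaf 38996230))))
    (.br 27198832849945099 97
    (.br 918217405029095034999836777740391811059210476371295108324740106178 36
    (.br 1925413458096086209869733063893958650118152978598 19
    (.br 4364988138939117791887736802706 69
    (.br 158107240623990305265651781 14
    (.leaf 225)
    (.leaf 136872529))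
    (.br 4087156801238926200273 68
    (.leaf 914)
    (.leaf 0)))
    (.br 148008216085244713289806237209321761545980420 10
    (.leaf 737)
    (.leaf 0)))
    (.br 605301560149307328433 17
    (.br 117928277128198843980667670265557051367451563737438490129132706174590086658561292826247218 96
    (.leaf 387314782535946)
    (.leaf 4554890))
    (.br 606490508924115159001 10
    (.br 1627550719912440371227527650891415371501071935794413963617 68
    (.leaf 56933178131190182)
    (.leaf 93915942))
    (.br 68048647979599329 37
    (.br 3111798375218 68
    (.leaf 39724359789085778)
    (.br 2897 14
    (.leaf 483)
    (.leaf 0)))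
    (.br 6490034 68
    (.leaf 7935172535955226215645382)
    (.br 20479453178300370 104
    (.leaf 783)
    (.leaf 0)))))))
    (.br 1641547405957948380968777221426 33
    (.br 80491231427344055150571500900528994211879119351647923147417512618158961040757589175938492305930588152431682 17
    (.leaf 21709176352964902)
    (.br 112824846726 98
    (.leaf 288837075215)
    (.leaf 0)))
    (.br 2816130643297574 67
    (.br 898568309477868919804828059717180982538 96
    (.br 16964069374936240604449322823277237674820459487373056117679560477163510542434626 36
    (.leaf 34964657)
    (.leaf 2481))
    (.br 67470242640822651565824424767987945402599490 17
    (.leaf 17889731512371799414588925867655217)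
    (.br 62715223386621248601931477972452934 98
    (.leaf 8880144)
    (.leaf 0))))
    (.br 49037693450735755738252614 3
    (.br 19033924759084236816152848469935463983329707655901519192529938341331266 96
    (.leaf 10912244629966034234896295833993232)
    (.br 40989942735013113 14
    (.leaf 227)
    (.leaf 0)))
    (.br 92896015122705810280105444674 10
    (.leaf 91847289782864552091857667000753850599854058257624371106449201)
    (.br 306690420094191862625 36
    (.leaf 42351378236644050915001393)
    (.br 1329 42
    (.leaf 7996047)
    (.leaf 0)))))))))))
    (.br 22872486 36
    (.br 330137200406578112514090916575592835818020145301952968623748442813050953767667664194 8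
    (.br 191590550591931878245647859560867926755125263080731247472562243588026143706320305437144912679251154193929122234586448775637213854101184939394946 11
    (.br 8888610591374126870763743823712288807696191990977750847553681 4
    (.br 75719770517284995503422004090073458854508434532436423 67
    (.leaf 1071098489077095825953)
    (.leaf 637822142789))
    (.br 1672479018360159348560730064964 68
    (.leaf 1421557107133000548551)
    (.br 2257 82
    (.leaf 37881031)
    (.leaf 2247))))
    (.br 1330832767577642027497137734148 16
    (.leaf 11522226391186841198722563774234959927440305533991599187736610092706099846416979)
    (.br 1072097896561172164618766944199 17
    (.leaf 2125180353235003392010400776445154489699095675787)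
    (.br 1997225001995 40
    (.br 68 82
    (.br 1172545537029 35
    (.leaf 819257)
    (.leaf 0))
    (.br 0 4
    (.leaf 6848722)
    (.br 0 35
    (.leaf 313)
    (.leaf 0))))
    (.leaf 545)))))
    (.br 561479036947974423813 10
    (.br 552451915287624184053384220976539777681904220168039709209918661665279150956422966518869750117647591116640070447470315778 68
    (.br 58931985168218916474551144025215510123840851 67
    (.leaf 16916423419759588841607751013269665)
    (.leaf 2561952516450))
    (.br 96424330709517875080692413471195332 82
    (.br 80018662322510546803950407 97
    (.leaf 4885564391593)
    (.leaf 3270))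
    (.br 1547509940250529559771783299271 3
    (.leaf 554571639823344959673)
    (.leaf 0))))
    (.br 15830315568623433678161169 67
    (.br 992330091116214074961141703425203485453216290367429259902859708290 17
    (.br 55927822284067362830025396239522290316413091 68
    (.br 2389246377179667891569920933959 34
    (.leaf 49944551531989373426106921)
    (.leaf 98263196710835774879498441))
    (.br 8033431219820196102996362812754505 70
    (.leaf 2792808022611)
    (.br 64261459 40
    (.leaf 644)
    (.leaf 0))))
    (.br 3572317534864218636078946232659068056602372 68
    (.br 124771174595736277694150699284100505753268726245974352684191037101015111 11
    (.leaf 1110275916601)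
    (.leaf 138))
    (.br 67906475953784785 96
    (.br 3180849490301476682745058163411946700841 70
    (.br 868755997267 56
    (.leaf 292)
    (.leaf 0))
    (.leaf 181540260179))
    (.br 2316237671137393541673 70
    (.leaf 5603923)
    (.br 2003 11
    (.leaf 825)
    (.leaf 0))))))
    (.br 1822419004339324551210278908728587813027 66
    (.br 2159324345488900250822432268826842404375085162034862900766194302764790963109017452166126896130 68
    (.leaf 16079758410580307)
    (.leaf 88033988746349010))
    (.br 22291135475345537009616211 97
    (.br 898563114841318218389915622439500974082 3
    (.br 419917762314496260820261531725696696021936387587714843146 40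
    (.leaf 1429239858066)
    (.leaf 10738828595))
    (.br 2242456287241113993385 9
    (.leaf 49693374247200446529673006073610996)
    (.br 684602942566009138955998988178 35
    (.leaf 10256505)
    (.leaf 43))))
    (.br 46280548541211207356777689 96
    (.br 13656339811031421010528414607029834649669161494053122 99
    (.leaf 2153889112896507038959364)
    (.leaf 5947825339891972))
    (.br 1431969675830802646274 9
    (.leaf 1330236142040412497138726315403060228538616709224)
    (.br 42960310526739218 40
    (.leaf 15869162092886467151069416)
    (.br 40042576 42
    (.leaf 232)
    (.leaf 0))))))))))
    (.br 842815491669040595619 10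
    (.br 2900308278586968741041746285210493984609089667725441873449208219923673007502710896335905804376757830978 4
    (.br 1270695685647517138647052932282265989030617918539064245030393360834947640208442472416391303169936928939717906320776709317339890604361421122127613396454071873468137761 96
    (.br 28053270467325961379275718185746565335943138 3
    (.leaf 25368708596138201)
    (.leaf 0))
    (.br 15305212596519906 3
    (.br 84659274117807807069924049247830233 72
    (.leaf 40960423)
    (.leaf 0))
    (.leaf 1250)))
    (.br 568014800201 68
    (.br 61734953645967054121164482307138635989864250277232456852689600665498008829999870066788641 50
    (.br 140164740806283722987586186642696838187614983 9
    (.br 44176376978297479713037160184578322 67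
    (.leaf 339)
    (.leaf 0))
    (.br 1204844530066 3
    (.leaf 27843904064842568993376050)
    (.leaf 10028082)))
    (.br 87421150542904891595621906 96
    (.br 182130359340660306097656040082903270370 16
    (.leaf 515)
    (.leaf 102006953))
    (.br 532732524961997325922 16
    (.leaf 515)
    (.leaf 7407913))))
    (.br 1806183872196570314676659356969 6
    (.br 2247922391574563515782545836867433334444568184513 96
    (.br 986957669618525306471955133804930416510304441568154683809 48
    (.br 44780242383491683100122184826357909619409074 80
    (.leaf 347919810770)
    (.leaf 3661546196294))
    (.br 152273952114382866098 80
    (.leaf 60673854636459594737061158)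
    (.leaf 101496289864755545637830905667585746)))
    (.br 620814663852558507561515771532909512358 32
    (.br 42068631738310648136304595633833025 97
    (.leaf 29130588677271466671276814)
    (.leaf 6490382))
    (.br 1488069890639208668322412495842 97
    (.leaf 900459069439256857158)
    (.br 40044230 104
    (.leaf 522)
    (.leaf 0)))))
    (.br 58826370814265557188 96
    (.br 22466730813104679328153655802927965651461864417066375255439996344330115957688129 48
    (.br 3506610139552246622578617506573413744818 82
    (.leaf 675404710599)
    (.leaf 48464583))
    (.br 65796775148586790 38
    (.br 65551700018627635 82
    (.leaf 21103303)
    (.leaf 0))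
    (.br 25440278859186867 82
    (.leaf 675404710599)
    (.leaf 1607))))
    (.br 49612410476807749157430123776114867 38
    (.br 1013940178445792649753492752577 2
    (.br 7952431557673105 82
    (.br 3386598621767 97
    (.leaf 1229050811288054337734)
    (.leaf 86182982))
    (.leaf 75482548064019837022863569))
    (.leaf 18459154248445110377716875812963399))
    (.br 1461369537841 32
    (.br 1038136232851183528771359871074453128001 16
    (.leaf 643)
    (.leaf 2246))
    (.br 27297089 70
    (.br 29944325182357987 97
    (.leaf 933893898634560474182)
    (.leaf 56821958))
    (.br 29907624705590598 2
    (.leaf 225489617041)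
    (.leaf 0)))))))))
    (.br 8620874483860099 40
    (.br 14381394397100828795647118324133601499980922333333193211697429634147928915154077145706389620644473386472014787406474292299074 16
    (.br 20012229631433996945101682906045015192464313870036737670435970805559379398428123037763379759056908234087226138001703 3
    (.br 34470529493454352461127224989539794901607349944977732 96
    (.leaf 23855697917804686)
    (.leaf 0))
    (.br 1851620330267404959833 96
    (.br 15780237099416094817989402070974606 9
    (.leaf 518657278788)
    (.leaf 196))
    (.leaf 1722301907908)))
    (.br 40160562185467896546821449 17
    (.br 1480964096952611546302747735059507924230225178428413927131339490483 3
    (.br 979669955879475746362814088552768472004 38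
    (.leaf 26837809)
    (.leaf 0))
    (.br 21269622805282354436539972 48
    (.leaf 760221958567)
    (.br 196 97
    (.leaf 418772058245)
    (.leaf 0))))
    (.br 1410063850575309766882 48
    (.br 1717046923963288670786779896203647518267921367335 3
    (.br 1051910515307206608994376104228392512729477417284 5
    (.leaf 30435394548957254)
    (.leaf 2686584424134))
    (.br 60863637070173939597640644 67
    (.leaf 914359288954868269836)
    (.br 1883399980614 11
    (.leaf 602)
    (.leaf 0))))
    (.br 14883137608090182 3
    (.br 737149483942255227334210820688067337091673939158459614916 50
    (.br 64812862564107303 37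
    (.leaf 690)
    (.leaf 0))
    (.br 23857016474239655 37
    (.leaf 575549768370)
    (.leaf 1970)))
    (.br 1624366994050646877342123063349552415300 50
    (.br 830016193319 37
    (.leaf 24150706)
    (.br 14222386 67
    (.leaf 25985865)
    (.leaf 0)))
    (.br 167 49
    (.br 13763366 67
    (.leaf 841)
    (.leaf 0))
    (.br 166 32
    (.leaf 6896349531078789)
    (.leaf 0))))))))
    (.br 575548195489 8
    (.br 2897314361008634221921677853505326359108073895772632303469024532879970864435405902009837473162507610091568218732806940793576162370 11
    (.br 176442520057940608258 104
    (.br 2412160562314383126657040407829164159122963510062610450113 38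
    (.br 3572748336208570871787665590980 37
    (.br 24982883111865927 82
    (.leaf 29492101)
    (.leaf 0))
    (.br 35228466 82
    (.leaf 29492167)
    (.leaf 2887)))
    (.br 31696824757039655308330675 5
    (.leaf 979643873244204362186330584441957843012)
    (.br 56543160709612082 69
    (.br 1275170628853721924625 67
    (.leaf 11108690)
    (.leaf 0))
    (.br 25404957097395780 4
    (.leaf 16924184425300434)
    (.leaf 0)))))
    (.br 51832339216902354597159034788110247678575201 4
    (.leaf 16971827077708332770732079809521004332093065959526351469615356460186789406471312973072065)
    (.br 930941076819 64
    (.br 7274176313525164849376517250232641224116402 80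
    (.leaf 85305351586574827202904519)
    (.br 2378411115281 81
    (.leaf 31654788)
    (.leaf 1350)))
    (.br 1013905005835984294130635834662 38
    (.leaf 19104691)
    (.br 43582771 97
    (.leaf 966)
    (.leaf 26804678))))))
    (.br 38492898170372356 104
    (.br 187434818823052784141195923851610981697 16
    (.leaf 11081616298881980761547926614411106803661764560771897729221050289163220218598196530854278412338818)
    (.br 15981860161589256653013125 1
    (.br 32150688453154879747360967 5
    (.leaf 18172202430532760645468710)
    (.br 2425655363763 37
    (.leaf 946)
    (.leaf 50)))
    (.br 486538716930694677843 50
    (.leaf 82826526618878887)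
    (.br 1415235306791 67
    (.leaf 465)
    (.leaf 0)))))
    (.br 1002908877153 4
    (.leaf 23630043083033517519409162147227068531441205130439470271752035614252136984357572418940808932132226)
    (.br 38879850031940658 16
    (.leaf 20142207659482469604452528268585242940607136975059549271447980185767907597598470241846721)
    (.br 1037268354119 1
    (.br 2676120915557075175695866640198780830519796139841 69
    (.leaf 30470531692691878)
    (.br 709 97
    (.leaf 13828390)
    (.leaf 0)))
    (.br 24785841131255350429113567415436339 64
    (.br 728010785191 67
    (.leaf 11632978)
    (.leaf 0))
    (.br 0 67
    (.leaf 15827410)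
    (.leaf 0))))))))
    (.br 15958673 67
    (.br 640731381103470093907532174445338723458 38
    (.br 1048537140972201445864220525363 17
    (.br 65079991790218793205497032835943554917280825898930068126958070681341673265087352204744842045193878808625346 97
    (.br 8737929446825506086907284448705934452164444774358726073584481 68
    (.leaf 979)
    (.leaf 0))
    (.br 2957336302646991325765 96
    (.leaf 11751861606744334)
    (.leaf 0)))
    (.br 58218090389594787390097284 68
    (.br 33092658383158168146661440133544923849415765770106921109473230114439722239824920256760652967222140614020730474004546 96
    (.br 487748832231362830364960030986 24
    (.leaf 15305899807932971)
    (.leaf 148176699435))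
    (.leaf 43353899))
    (.br 2592290418444865877283750316113 97
    (.br 608464007558117814344031350403878198587872340724467960386 49
    (.br 822139747824918921510 70
    (.leaf 117589755782529363)
    (.leaf 104078544570977235))
    (.br 9361887330765350 70
    (.leaf 29395414823581556190511443)
    (.leaf 14887862252837025853246035)))
    (.br 62835946140005501540938959937538098 33
    (.leaf 126180997581727612422098429499506797671072754989826626)
    (.br 59368833322665519853263765531976767941707842 82
    (.leaf 583)
    (.leaf 2119))))))
    (.br 56029636850394846560094161144468734487829614392640691 17
    (.br 83523195043767445316940273578686717936460672531270226896900007235485858 97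
    (.br 12254637008157701706363174550994897542688387208610370 70
    (.leaf 122222836456811491722249757976199635)
    (.br 94636599048076420302801363 68
    (.leaf 928847856457)
    (.leaf 969)))
    (.br 2620726846303927466434778204231 65
    (.br 10049202824953732543054177 98
    (.leaf 454343572821400256782)
    (.leaf 65175621))
    (.leaf 601832695813718050401)))
    (.br 24937606 96
    (.br 463868523773759639115610027197865344481535002178 68
    (.leaf 95832608421134113497264342217595870254656202942965073444538600150831900192360041824918410412945867764047897548447516722)
    (.br 1188641048145 49
    (.br 3308430670542095273433825116752904278015656692039 69
    (.leaf 2840678071368651341675537550362718568914)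
    (.leaf 3415507262715138555675122734737590443285108033874))
    (.br 54939569832238649981966321684772656980390469406187442210637350 70
    (.leaf 17343119218676149896151635)
    (.leaf 60863710832521166450918995))))
    (.br 17908590316687451465385161 97
    (.br 804587753684099425238404026405360652424498782869665154882 49
    (.br 14962625701538860557074854 70
    (.leaf 3498525467845363575477286109651)
    (.leaf 93869861280588374838255960157489491))
    (.br 39140551780006137063474982 70
    (.leaf 2864680824327821215904907297235)
    (.leaf 75735877995202638943539488341788499)))
    (.br 26490349626260709144312212551304370 33
    (.br 102236258551831499298963895764622054983424581179114434 42
    (.leaf 94536775)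
    (.leaf 65548486323242867089442501))
    (.br 50613207149625428913630470428352630860350658 70
    (.br 467 98
    (.leaf 492854313104)
    (.leaf 0))
    (.br 1317505434835 103
    (.leaf 2621456)
    (.leaf 0))))))))
    (.br 752883427882677371590 66
    (.br 1861039251670123699128857553490544730896948422761798990389567291423116929818586036977582029712399057489974774573048070850 38
    (.br 573168165849758242834441831219 68
    (.leaf 130281787024964640313858077399641063474)
    (.br 83633985835796274 97
    (.leaf 643340720326026494313)
    (.leaf 1838)))
    (.br 57005160726499712714075899315 70
    (.br 6016777848422611 74
    (.leaf 13411654553692912816850658)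
    (.br 40960969 79
    (.leaf 98)
    (.leaf 335)))
    (.br 1513040773710533 72
    (.leaf 792433066082)
    (.leaf 994))))
    (.br 27828356071079650552419019007263362 64
    (.br 21091665636387824527670848797586662804050065589346821109514628 50
    (.br 2397955011011801048051861138279723403186 97
    (.br 3239352562004146355181443072671307074082 68
    (.leaf 3815353302869971354751739560553)
    (.leaf 85920589982138894))
    (.br 2388682989512169012113898406839255893154 35
    (.leaf 201)
    (.leaf 0)))
    (.br 1282556126967302783573945418919 97
    (.br 614120655646397770286586077158433162914 68
    (.br 595478702547942106347469046162 35
    (.leaf 379321662864169042297)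
    (.leaf 6422582204108791037069330))
    (.br 11258433039277738361947013 105
    (.leaf 9568500)
    (.leaf 457428992489)))
    (.br 61418126778025463206794325663882247299374055842 68
    (.br 1634850610199845437649 96
    (.leaf 4522185)
    (.leaf 0))
    (.br 38076805 9
    (.leaf 372)
    (.leaf 0)))))
    (.br 24392224315552319850988150791870994402411170 50
    (.br 787495139440627778529 97
    (.br 968254245585675591106712994914592019281805803843590030575901249940232931204 37
    (.leaf 562)
    (.leaf 2098))
    (.br 1891994222628562994610 17
    (.leaf 1054109158106984553896436078658858582822)
    (.br 1634887906150752519078 42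
    (.leaf 642034159675933550096079839081336538884)
    (.br 650 3
    (.leaf 6422827708692616253833337)
    (.leaf 42762666)))))
    (.br 425224143527 97
    (.br 16901554019774372059402544987820886127149793 17
    (.br 371096640407248918334010943496052562658648588466 9
    (.leaf 516)
    (.leaf 0))
    (.br 121103554324990198922 37
    (.br 14990472082817714 3
    (.leaf 3964944)
    (.leaf 26543888))
    (.br 15780197469844412615222940210365444 115
    (.leaf 121)
    (.leaf 0))))
    (.br 22729806604697844 17
    (.br 25912668266303529607036883901048117491244225497036920487870642 3
    (.leaf 26844921866)
    (.leaf 0))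
    (.br 22870024416199334 9
    (.leaf 25629659168811706965255749555483080327452270196753249)
    (.br 33264164391401712164326531927376050 42
    (.leaf 1832616179275685857750765239290388665100376507361)
    (.br 180 96
    (.br 141759906565 104
    (.leaf 4333240580)
    (.leaf 17205560068))
    (.leaf 5780329914156445799547396)))))))))))))))
    (by decide) (by decide +kernel)

lemma good_relaxed_head :
    Good 256 [7, 11, 56, 224]
      (twin 0 1 headPotential) :=
  Packed.good_of_check
    (.br 169577144900376720562933615790710369211226273234147400561401620540841435624814247478696326032390874515717499357868345902950844161 225
    (.br 18868845844005359195320656000832310465 129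
    (.br 12247967758000851458167384070025648083739254438093219942639988087681879255487583753041 137
    (.br 2164252518019649937075937388768479950440773965606011647423842420102 17
    (.br 166079797167430112158152297958911677102347255403897909578535701777254386835140673932657464621170963357509694282115744889138948002700664833835662985536571167122001108802 33
    (.br 136218500264211230358823946572871936756612218791166924692635797446605787330712926101066818135800140082533 37
    (.br 10856161299624051688480454261791100566662184685935458 4
    (.br 5892344161279257502618814474 3
    (.leaf 9063327664189774580357340521)
    (.leaf 1398670364104008274))
    (.leaf 57941964286936878750034))
    (.br 534039379113908257606496509263302481316695256610517799848313649175628586487712773 68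
    (.leaf 799719208572818185)
    (.leaf 4194)))
    (.br 28708565280482098469070835064742246737009297938561348132869153914837083989835206596330645663316353359941 1
    (.br 167726074548343872885294442807329 73
    (.br 9330704903432777699777545830855475554 19
    (.leaf 2969971397433436012721)
    (.leaf 6916))
    (.br 25749600140684040311569387749449 8
    (.leaf 2220519391845)
    (.leaf 357)))
    (.br 2718593597868109754581705802108209769571466552673097 97
    (.leaf 38609257151871589353481)
    (.leaf 0))))
    (.br 506202943463873102491339030077592337748829268876395353093 16
    (.br 18544217754697258856439504507591826071198809322298684835105031497478232237721539818775552145729080794764592254310372769791150149813244664506676801400777996841217559298 81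
    (.br 270106128892946596300671062461566110708438544040422342677 97
    (.br 104978367334771187689565360555341 4
    (.leaf 306778665)
    (.leaf 0))
    (.br 3218213901660178005665323013 96
    (.leaf 1858)
    (.leaf 0)))
    (.br 661912324990396533990162548648840639039618144736552102875621362498 97
    (.leaf 136905749)
    (.leaf 8009)))
    (.br 8351075418264535621499289438176425336776472914165958 33
    (.br 760273550005670107293766359356843170646478458227285629167812551226959895758870502621152068340544019459829058518965702608368250058510048578 5
    (.br 191074716486588475816549772714285174356418434404546867687226197067019264104926309 144
    (.leaf 27190609978055748356356)
    (.leaf 0))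
    (.br 573692175381670730426758255674134 72
    (.leaf 1166845962943543720550557720403071590271333)
    (.br 53533430286807959994725 144
    (.leaf 96602372)
    (.leaf 0))))
    (.br 1525901296766948358 65
    (.br 145136087008407531327670413300609086933598661749405566902423251486677200408651110505543064756226 73
    (.br 3581467321591427585670927224419353447307591272606901752652787744869 131
    (.br 200015465694263515242140902470825070390917800708 36
    (.leaf 303432194)
    (.leaf 605430530))
    (.leaf 26679343870492684457219332))
    (.br 3476976175529284994829706115280510416692396841159526193934893648713 76
    (.leaf 90309990)
    (.leaf 33080360902404)))
    (.br 967528826298525010302594987475642848660999159550978 1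
    (.br 74757523515612796249153775386213970315318269964475512976207294913486675543045185167443731713874251088161 20
    (.leaf 55525837120260387966246)
    (.leaf 469506209534961795176043760457513))
    (.br 9514507813069931070829545750586599961817602203253421564026073496956992820246 145
    (.br 2680948770387172105837968011010588779856529908548595643274439564130 81
    (.leaf 3732513033061)
    (.leaf 6501))
    (.br 24533645519426449146957338604897175697 100
    (.br 43258265914855301193314 176
    (.leaf 900)
    (.leaf 0))
    (.leaf 1468757740446946658))))))))
    (.br 78046661578100049395962901491991709481850824691415434054270866113983071698617993 145
    (.br 501065001113333906156010134251065814920502693922389200709114796098 133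
    (.br 39065351516863547375429548290004334949638046997083584109431114424458757 33
    (.br 10239976229865460720265782602551173219680501633210346318336230316109859179878095339353618900547131535282590253666 17
    (.br 460409171536388820039835454397338489783044 24
    (.leaf 47300379643968867897115103789253)
    (.leaf 528380504824747609))
    (.br 136161660073738743282629682065079471661013831061593 81
    (.leaf 220006404)
    (.leaf 0)))
    (.br 568303697991362424317139370974277 1
    (.br 141926958787145934148731812124067511721017326493289221149642858850 17
    (.br 343910684809905349572322965000146706878869892473587751574144090918 160
    (.br 35491973580595459785869 72
    (.leaf 3429)
    (.leaf 2917))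
    (.leaf 591659365))
    (.leaf 43968478261473366601834910178936684817))
    (.br 1173289976601028664272061404102539714532253184267572572118068567570 97
    (.br 13150611112341311256936000450142057581174875713832525 92
    (.leaf 1618)
    (.leaf 1609))
    (.br 38635949148598242982053141935723192165 81
    (.leaf 30935993144858249595661)
    (.leaf 32337284111477)))))
    (.br 1158195865988295829272548917949854040790787221653465375631392882614238464625273893003408823565028777705927574629426956766147902193576290870618903656022071725853829 197
    (.br 16193774392909586727234438255166539135592395017128583781 97
    (.leaf 9688949221778611648499928026340525645)
    (.br 309059842394955594 33
    (.leaf 2637)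
    (.leaf 0)))
    (.br 224324478941122208924182787504022105407492855293775514693 73
    (.leaf 206900258)
    (.leaf 0))))
    (.br 4725915650307889217250672864752694960762426106820103473397211580628168684655054706127930466402649032247580905118002402895073568342098939784129763545102689617585440274 65
    (.br 2859107587312033871011978531618610379028905925485542976754373755490 73
    (.br 13603657722028889772156410407844066722782249573 36
    (.leaf 103351821)
    (.leaf 522788365))
    (.br 206074323453440065701930477095497 100
    (.leaf 2801100770141695446492972109)
    (.leaf 4941)))
    (.br 25949931378646500077262199153145167004258186051474534410096969 100
    (.br 13514800126603723498015853650908201174548174076958362959158114 12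
    (.leaf 421)
    (.leaf 598))
    (.br 353120638505730371096102239343458 165
    (.leaf 133492744306506747396621902975533227186261726757)
    (.leaf 173435758641661736269932153603621))))))
    (.br 100805772372246068682535486240297799447035027676236747748632759174 1
    (.br 430492388825858872553201040302280690080769355469056193515828775276871116774829528376884610341677624333874646111453081035764369743084949360673580985149306817022296504317882146680786140504079206235624089194641728697663873 17
    (.br 361025744517058266271909130796126452419037435239767064255976959142100401638603539185859403473618514 73
    (.br 1039949710610707398320811102777779649739246968847834978270622406082510521168865017662424363046174537875810 9
    (.br 6234430545158438311747191078 3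
    (.leaf 170632486867296090980642)
    (.leaf 8226))
    (.br 85095840355526279041289 3
    (.leaf 354)
    (.leaf 0)))
    (.br 130732354414882468842464397821769 9
    (.leaf 51722072610232774305524346408854227991804707824042374881696479108487318101176338522070059980045103598800076085026)
    (.br 8651965752861929047817 197
    (.br 368283091735878128782889623166978231204006180597878883353 19
    (.leaf 82089258921164995166498)
    (.leaf 53441029369955371585028))
    (.br 147601863117943647288263752334001909171648207749157881797 4
    (.leaf 25254009506953903539177)
    (.leaf 0)))))
    (.br 375282362639057977593189404295277052812271515501457763487425333842095544861851921 73
    (.br 10546352645636736515793808454273362173431597593295176809103060237718907060578 81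
    (.leaf 193842650065935291300049720618510589391711018992114898188347513369658310)
    (.br 1982489673556761416146800216145 36
    (.leaf 1801)
    (.leaf 0)))
    (.br 1421718857707761689952722098141438764187977 9
    (.br 32190826382937021329435803944363297840579111552434006937468637435622380666159461 20
    (.leaf 130615746)
    (.leaf 269877858))
    (.br 43496384532628880418117485986057 197
    (.br 1829018065353839506669412366074996418377749270 20
    (.leaf 6743201744585)
    (.leaf 0))
    (.br 15500592349637 21
    (.leaf 6979435692482)
    (.leaf 277))))))
    (.br 54972569095713221232108508605466429682770906197 17
    (.br 197305907557839177704987651433430392800655047813404025171003917013852906575486710499643623949842016628766081279518006744869938720505346683532946233162024851029442387796769650431090047875271988632334580039402540534204827462292838026464917493495883510221769923498306 72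
    (.leaf 348788883512309358550281767570643668187048047100088027290847092030223374767575625208067131756530359826069434739417779447607462758)
    (.br 701262660938730204561539878 25
    (.br 2006282749804570306106366594514156273574657403154384380212208337094 5
    (.leaf 950011322335686066591892243914744113003062406742093)
    (.br 42741767214281410543693 137
    (.leaf 156043561)
    (.leaf 2381)))
    (.br 56427486790406574635115305361313181401790220085185209756290032911058441 89
    (.leaf 6343700645318)
    (.leaf 240383366838945354))))
    (.br 4269101433433166707684373924652638812425459842812678 65
    (.br 3323623402075799412716147903765011454685872510887232026779719405828903518806348555476756180871807586 73
    (.br 1162724616915353886169219342619673046864526608318225112731665179323363033445 81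
    (.br 639073024259164298442564874794525133381600802639480284787296357123842001409428560784202642 4
    (.br 71943285104617358267890182007976175268160218757 19
    (.leaf 2385400047184555712575968917265528031292557)
    (.leaf 12679782653330312975272329777299193988))
    (.leaf 786008046851505151509928340024044067780522806547363558808343014239349306072308241))
    (.br 11265355331398146445072948304436169113694726328143848400155438470487729478409902041307351137442138129 131
    (.leaf 110447586242464797527542548471045)
    (.leaf 24850709976634306316545868210801545733)))
    (.br 38989697795947246158398803239513139338834386381637724825572166442128293703183566066873272118408470133002012233 81
    (.br 141037374359645292628851487979946153257815789153974995279656937542002307747682065 201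
    (.leaf 2530696598977816821793702864911848115150473)
    (.leaf 1224026931898381985884601416128764444216457))
    (.br 61305622096932374124189833577227727492487597026240041070518928977 100
    (.leaf 110447643035138660031501659866445)
    (.leaf 2125))))
    (.br 80072602377254957771472494749315894897340314698747075916961833290108005 81
    (.br 523359602182744277718067788875504033974938036385164253633642563654277919446004266995228988520114028306851826178963271702696023539002036408306691566944488663297543950561462850321 132
    (.br 70248424397662063709577153732771579146038544201 137
    (.leaf 11171313092121)
    (.leaf 14126183486937))
    (.br 209006528263334903319605707674506 72
    (.leaf 1902879456255986752179799750)
    (.br 4996 73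
    (.leaf 73532614)
    (.leaf 0))))
    (.br 3498675982491698649396480901 73
    (.br 7893131847940705388826976433900566298324947081706592593410756643596009134402271345102492220336436204753918102522964723720039726982052977462217613899215635617021277933479577648085938060558771294882 16
    (.leaf 185396922626355101441026636908173)
    (.leaf 6103417819141))
    (.br 3183155216164571108881075042 145
    (.br 1632505749490647445691522792791464284294655963360304187363834190524223795790978458721187952109463319045574921361643608427962016828051559185 196
    (.leaf 5896024657203840395671833226)
    (.leaf 5962461176229940645507502929))
    (.br 16170724101002 193
    (.br 26124542521432629677950261801099538449209671200431260377050824298794914 16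
    (.br 11724510978877672144858490766796718896919930603478906192066536414029415497215675010637 4
    (.leaf 2099986864916998970716259081)
    (.leaf 469504127052022449))
    (.br 20540131737089886542517037861858038950224268809 196
    (.br 7641711251356259016497501069 176
    (.leaf 343415195538033028)
    (.leaf 147776892580992132))
    (.leaf 19528607595746162481777112297807610701)))
    (.br 235337256232421134532479928430859773034290618054405327109 16
    (.br 56516308927409939185737624491311705068586327987916427537574526632815373088809007250902864171682 8
    (.leaf 853774840089911529908486803454966822470598)
    (.br 3865500321734 209
    (.leaf 253331658093953993)
    (.leaf 0)))
    (.br 3585122836511804517906453437339030148869535434345378 136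
    (.leaf 9502052598155107341927459376388442054)
    (.br 766188480199723341 80
    (.leaf 7576486150598)
    (.leaf 0))))))))))))
    (.br 428217247172066941678967106819417188641891119719498931605825949735755653100532859205709892668448386418704852645167652830460565354531563959183578696743063649935511865732469824675110584933954909019461473016236278205005983341934393535116643892389869521608125684271769738838457738505389593318642385639846817392887426 16
    (.br 66457165424706714090375739236150753064531556837887080000098105004692643924271086640406239112394720512280300866117115552489368334251699388754546861316120402240687459483928698064015553 19
    (.br 27801327741664836498125519435380410784657629720187931956679205 76
    (.leaf 682538827239867942020)
    (.leaf 1217))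
    (.br 5724740739092306727566186384856226609016558552679684 32
    (.leaf 5716826355422930951972783870955488132)
    (.br 435164179704581453 67
    (.leaf 109315681)
    (.leaf 0))))
    (.br 101264392678578901176959685863842378062202547513264649801106754421717396114372187308080514285093611022029867666622450277 192
    (.br 1167078991150359678413824842405029553322798276620587923460388358098 131
    (.leaf 3233615200199662492139945709600211319485695473)
    (.br 7372267861165870675291861487761 240
    (.leaf 136235830076506901)
    (.leaf 277)))
    (.br 901669884580416343572399485801376618638647790789569817447218101047790031333699091134809988 64
    (.leaf 2046714308789469586681562753)
    (.leaf 295372410606130568436376225212199901659569)))))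
    (by decide) (by decide +kernel)

lemma good_head : Good (2 ^ 8) [7, 11, 56, 224] headPotential := by
  have h0 := good_relaxed_head
  have h1 := Good.of_twin (n := 8) h0 (by decide) (by decide) (by decide) (by decide +kernel)
  exact h1

end Certificates

/-- A set `S` of triples in a union-closed family `F` all of whose elements lie in fewer than half
  of
the members of `F`. -/
structure Deficient (F S : Finset (Finset ℕ)) : Prop where
  uc : UC F
  sub : ∀ ⦃e⦄, e ∈ S → e ∈ F
  card : ∀ ⦃e⦄, e ∈ S → e.card = 3
  neg : ∀ ⦃e⦄, e ∈ S → ∀ ⦃i⦄, i ∈ e → excess F i < 0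

section Deficient

variable {F S R : Finset (Finset ℕ)}

lemma Deficient.false_of_triangle (hD : Deficient F S) {a b c d : ℕ}
    (hv : [a, b, c, d].Nodup)
    (h1 : {a, b, c} ∈ S) (h2 : {a, b, d} ∈ S) (h3 : {a, c, d} ∈ S) : False := by
  refine Good.false_of_lin hD.uc hv good_triangle ?_ ?_ (by decide) (by simp) (by simp)
  · simp [select, hD.sub h1, hD.sub h2, hD.sub h3]
  · simp only [List.forall_mem_cons]
    exact ⟨hD.neg h1 (by simp), hD.neg h1 (by simp), hD.neg h1 (by simp), hD.neg h2 (by simp),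
      by simp⟩

lemma Deficient.false_of_star (hD : Deficient F S) {a b c d e : ℕ}
    (hv : [a, b, c, d, e].Nodup)
    (h1 : {a, b, c} ∈ S) (h2 : {a, b, d} ∈ S) (h3 : {a, b, e} ∈ S) : False := by
  refine Good.false_of_lin hD.uc hv good_star ?_ ?_ (by decide) (by simp) (by simp)
  · simp [select, hD.sub h1, hD.sub h2, hD.sub h3]
  · simp only [List.forall_mem_cons]
    exact ⟨hD.neg h1 (by simp), hD.neg h1 (by simp), hD.neg h1 (by simp), hD.neg h2 (by simp),
      hD.neg h3 (by simp), by simp⟩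

lemma Deficient.false_of_path (hD : Deficient F S) {a b c d e : ℕ}
    (hv : [a, b, c, d, e].Nodup)
    (h1 : {a, b, c} ∈ S) (h2 : {a, c, d} ∈ S) (h3 : {a, d, e} ∈ S) : False := by
  refine Good.false_of_lin hD.uc hv good_path ?_ ?_ (by decide) (by simp) (by simp)
  · simp [select, hD.sub h1, hD.sub h2, hD.sub h3]
  · simp only [List.forall_mem_cons]
    exact ⟨hD.neg h1 (by simp), hD.neg h1 (by simp), hD.neg h1 (by simp), hD.neg h2 (by simp),
      hD.neg h3 (by simp), by simp⟩

lemma Deficient.false_of_cherry (hD : Deficient F S) {a b c d e f : ℕ}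
    (hv : [a, b, c, d, e, f].Nodup)
    (h1 : {a, b, c} ∈ S) (h2 : {a, b, d} ∈ S) (h3 : {a, e, f} ∈ S) : False := by
  refine Good.false_of_lin hD.uc hv good_cherry ?_ ?_ (by decide) (by simp) (by simp)
  · simp [select, hD.sub h1, hD.sub h2, hD.sub h3]
  · simp only [List.forall_mem_cons]
    exact ⟨hD.neg h1 (by simp), hD.neg h1 (by simp), hD.neg h1 (by simp), hD.neg h2 (by simp),
      hD.neg h3 (by simp), hD.neg h3 (by simp), by simp⟩

lemma Deficient.false_of_matching (hD : Deficient F S) {a b c d e f g : ℕ}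
    (hv : [a, b, c, d, e, f, g].Nodup)
    (h1 : {a, b, c} ∈ S) (h2 : {a, d, e} ∈ S) (h3 : {a, f, g} ∈ S) : False := by
  refine Good.false_of_lin hD.uc hv good_matching ?_ ?_ (by decide) (by simp) (by simp)
  · simp [select, hD.sub h1, hD.sub h2, hD.sub h3]
  · simp only [List.forall_mem_cons]
    exact ⟨hD.neg h1 (by simp), hD.neg h1 (by simp), hD.neg h1 (by simp), hD.neg h2 (by simp),
      hD.neg h2 (by simp), hD.neg h3 (by simp), hD.neg h3 (by simp), by simp⟩

lemma Deficient.false_of_kite (hD : Deficient F S) {a b c d e : ℕ}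
    (hv : [a, b, c, d, e].Nodup)
    (h1 : {a, b, c} ∈ S) (h2 : {a, b, d} ∈ S) (h3 : {c, d, e} ∈ S) : False := by
  refine Good.false_of_lin hD.uc hv good_kite ?_ ?_ (by decide) (by simp) (by simp)
  · simp [select, hD.sub h1, hD.sub h2, hD.sub h3]
  · simp only [List.forall_mem_cons]
    exact ⟨hD.neg h1 (by simp), hD.neg h1 (by simp), hD.neg h1 (by simp), hD.neg h2 (by simp),
      hD.neg h3 (by simp), by simp⟩

lemma Deficient.false_of_looseTriangle (hD : Deficient F S) {a b c d e f : ℕ}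
    (hv : [a, b, c, d, e, f].Nodup)
    (h1 : {a, b, c} ∈ S) (h2 : {c, d, e} ∈ S) (h3 : {a, e, f} ∈ S) : False := by
  refine Good.false_of_lin hD.uc hv good_looseTriangle ?_ ?_ (by decide) (by simp) (by simp)
  · simp [select, hD.sub h1, hD.sub h2, hD.sub h3]
  · simp only [List.forall_mem_cons]
    exact ⟨hD.neg h1 (by simp), hD.neg h1 (by simp), hD.neg h1 (by simp), hD.neg h2 (by simp),
      hD.neg h2 (by simp), hD.neg h3 (by simp), by simp⟩

lemma Deficient.false_of_disjointFork (hD : Deficient F S) {a b c d e f g h : ℕ}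
    (hv : [a, b, c, d, e, f, g, h].Nodup)
    (h1 : {a, b, c} ∈ S) (h2 : {a, b, d} ∈ S) (h3 : {c, e, f} ∈ S)
    (h4 : {d, g, h} ∈ S) : False := by
  refine Good.false_of_lin hD.uc hv good_disjointFork ?_ ?_ (by decide) (by simp) (by simp)
  · simp [select, hD.sub h1, hD.sub h2, hD.sub h3, hD.sub h4]
  · simp only [List.forall_mem_cons]
    exact ⟨hD.neg h1 (by simp), hD.neg h1 (by simp), hD.neg h1 (by simp), hD.neg h2 (by simp),
      hD.neg h3 (by simp), hD.neg h3 (by simp), hD.neg h4 (by simp), hD.neg h4 (by simp), by simp⟩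

lemma Deficient.false_of_meetingFork (hD : Deficient F S) {a b c d e f g : ℕ}
    (hv : [a, b, c, d, e, f, g].Nodup)
    (h1 : {a, b, c} ∈ S) (h2 : {a, b, d} ∈ S) (h3 : {c, e, f} ∈ S)
    (h4 : {d, f, g} ∈ S) : False := by
  refine Good.false_of_lin hD.uc hv good_meetingFork ?_ ?_ (by decide) (by simp) (by simp)
  · simp [select, hD.sub h1, hD.sub h2, hD.sub h3, hD.sub h4]
  · simp only [List.forall_mem_cons]
    exact ⟨hD.neg h1 (by simp), hD.neg h1 (by simp), hD.neg h1 (by simp), hD.neg h2 (by simp),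
      hD.neg h3 (by simp), hD.neg h3 (by simp), hD.neg h4 (by simp), by simp⟩

lemma Deficient.false_of_doubleFork (hD : Deficient F S) {a b c d e f : ℕ}
    (hv : [a, b, c, d, e, f].Nodup)
    (h1 : {a, b, c} ∈ S) (h2 : {a, b, d} ∈ S) (h3 : {c, e, f} ∈ S)
    (h4 : {d, e, f} ∈ S) : False := by
  refine Good.false_of_lin hD.uc hv good_doubleFork ?_ ?_ (by decide) (by simp) (by simp)
  · simp [select, hD.sub h1, hD.sub h2, hD.sub h3, hD.sub h4]
  · simp only [List.forall_mem_cons]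
    exact ⟨hD.neg h1 (by simp), hD.neg h1 (by simp), hD.neg h1 (by simp), hD.neg h2 (by simp),
      hD.neg h3 (by simp), hD.neg h3 (by simp), by simp⟩

lemma Deficient.false_of_tripod (hD : Deficient F S) {a b c d e f g h i : ℕ}
    (hv : [a, b, c, d, e, f, g, h, i].Nodup)
    (h1 : {a, b, c} ∈ S) (h2 : {a, d, e} ∈ S) (h3 : {b, f, g} ∈ S)
    (h4 : {c, h, i} ∈ S) : False := by
  refine Good.false_of_lin hD.uc hv good_tripod ?_ ?_ (by decide) (by simp) (by simp)
  · simp [select, hD.sub h1, hD.sub h2, hD.sub h3, hD.sub h4]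
  · simp only [List.forall_mem_cons]
    exact ⟨hD.neg h1 (by simp), hD.neg h1 (by simp), hD.neg h1 (by simp), hD.neg h2 (by simp),
      hD.neg h2 (by simp), hD.neg h3 (by simp), hD.neg h3 (by simp), hD.neg h4 (by simp),
        hD.neg h4 (by simp), by simp⟩

lemma Deficient.false_of_shortChain (hD : Deficient F S) {a b c d e f g : ℕ}
    (hv : [a, b, c, d, e, f, g].Nodup)
    (h1 : {a, b, c} ∈ S) (h2 : {a, b, d} ∈ S) (h3 : {d, e, f} ∈ S)
    (h4 : {e, f, g} ∈ S) : False := by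
  refine Good.false_of_lin hD.uc hv good_shortChain ?_ ?_ (by decide) (by simp) (by simp)
  · simp [select, hD.sub h1, hD.sub h2, hD.sub h3, hD.sub h4]
  · simp only [List.forall_mem_cons]
    exact ⟨hD.neg h1 (by simp), hD.neg h1 (by simp), hD.neg h1 (by simp), hD.neg h2 (by simp),
      hD.neg h3 (by simp), hD.neg h3 (by simp), hD.neg h4 (by simp), by simp⟩

lemma Deficient.false_of_longChain (hD : Deficient F S) {a b c d e f g h i : ℕ}
    (hv : [a, b, c, d, e, f, g, h, i].Nodup)
    (h1 : {a, b, c} ∈ S) (h2 : {a, b, d} ∈ S) (h3 : {d, e, f} ∈ S) (h4 : {f, g, h} ∈ S)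
    (h5 : {g, h, i} ∈ S) : False := by
  refine Good.false_of_lin hD.uc hv good_longChain ?_ ?_ (by decide) (by simp) (by simp)
  · simp [select, hD.sub h1, hD.sub h2, hD.sub h3, hD.sub h4, hD.sub h5]
  · simp only [List.forall_mem_cons]
    exact ⟨hD.neg h1 (by simp), hD.neg h1 (by simp), hD.neg h1 (by simp), hD.neg h2 (by simp),
      hD.neg h3 (by simp), hD.neg h3 (by simp), hD.neg h4 (by simp), hD.neg h4 (by simp),
        hD.neg h5 (by simp), by simp⟩

/-- The total of the end potential over `F`. -/
def tailSum (F : Finset (Finset ℕ)) (v : List ℕ) : ℤ := ∑ A ∈ F, tail (code v A)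

lemma tailSum_reverse (F : Finset (Finset ℕ)) (a b c d e : ℕ) :
    tailSum F [e, d, c, b, a] = -tailSum F [a, b, c, d, e] := by
  unfold tailSum
  rw [← Finset.sum_neg_distrib]
  refine Finset.sum_congr rfl fun A _ => ?_
  simp only [code]
  generalize decide (a ∈ A) = a'
  generalize decide (b ∈ A) = b'
  generalize decide (c ∈ A) = c'
  generalize decide (d ∈ A) = d'
  generalize decide (e ∈ A) = e'
  revert a' b' c' d' e'
  decide

lemma Deficient.tailSum_pos_of_head (hD : Deficient F S) {a b c d e f g h : ℕ}
    (hv : [a, b, c, d, e, f, g, h].Nodup) (h1 : {a, b, c} ∈ S) (h2 : {a, b, d} ∈ S)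
    (h3 : {d, e, f} ∈ S) (h4 : {f, g, h} ∈ S) : 0 < tailSum F [d, e, f, g, h] := by
  have key := Good.sum_nonneg hD.uc hv good_head
    (by simp [select, hD.sub h1, hD.sub h2, hD.sub h3, hD.sub h4])
  have hneg := sum_lin_neg (F := F) (l := [5698, 5698, 3683, 8472, 5640, 4588])
    (v := [a, b, c, d, e, f, g, h]) (by decide)
    (by
      simp only [List.forall_mem_cons]
      exact ⟨hD.neg h1 (by simp), hD.neg h1 (by simp), hD.neg h1 (by simp), hD.neg h2 (by simp),
        hD.neg h3 (by simp), hD.neg h3 (by simp), hD.neg h4 (by simp), hD.neg h4 (by simp),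
        by simp⟩) (by simp) (by simp)
  have hdiv : ∀ A, code [a, b, c, d, e, f, g, h] A / 8 = code [d, e, f, g, h] A := fun A => by
    rw [show 8 = 2 * 2 * 2 from rfl, ← Nat.div_div_eq_div_mul, ← Nat.div_div_eq_div_mul]
    simp only [code, Nat.bit_div_two]
  simp only [headPotential, Finset.sum_add_distrib, hdiv] at key
  unfold tailSum
  linarith

lemma Deficient.tailSum_lt_of_link (hD : Deficient F S) {a b c d e f g : ℕ}
    (hv : [a, b, c, d, e, f, g].Nodup) (h1 : {a, b, c} ∈ S) (h2 : {c, d, e} ∈ S)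
    (h3 : {e, f, g} ∈ S) : tailSum F [a, b, c, d, e] < tailSum F [c, d, e, f, g] := by
  have key := Good.sum_nonneg (v := [a, b, c, d, e, f, g]) (F := F) hD.uc hv good_link
    (by simp [select, hD.sub h1, hD.sub h2, hD.sub h3])
  have hlin : ∑ A ∈ F, lin [0, 0, 5000, 6017, 5000] (code [a, b, c, d, e, f, g] A) < 0 := by
    have := hD.neg h1 (i := c) (by simp)
    have := hD.neg h2 (i := d) (by simp)
    have := hD.neg h2 (i := e) (by simp)
    iterate 5 rw [sum_lin_cons]
    simp only [lin, Finset.sum_const_zero]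
    linarith
  have hdiv : ∀ A, code [a, b, c, d, e, f, g] A / 4 = code [c, d, e, f, g] A := fun A => by
    rw [show 4 = 2 * 2 from rfl, ← Nat.div_div_eq_div_mul]
    simp only [code, Nat.bit_div_two]
  have hmod : ∀ A, code [a, b, c, d, e, f, g] A % 32 = code [a, b, c, d, e] A := fun A => by
    have := code_lt [a, b, c, d, e] A
    simp only [code, Nat.bit_val, List.length_cons, List.length_nil] at this ⊢
    omega
  simp only [linkPotential, Finset.sum_add_distrib, Finset.sum_sub_distrib, hdiv, hmod] at key
  unfold tailSum
  linarith

lemma ne_of_card_triple {a b c : ℕ} (h : ({a, b, c} : Finset ℕ).card = 3) :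
    a ≠ b ∧ a ≠ c ∧ b ≠ c := by
  have h2 := fun x y : ℕ => Finset.card_le_two (a := x) (b := y)
  refine ⟨?_, ?_, ?_⟩ <;> rintro rfl
  · have := h2 a c; simp at h; omega
  · have := h2 a b; rw [Finset.insert_comm] at h; simp at h; rw [Finset.pair_comm] at h; omega
  · have := h2 a b; simp at h; omega

lemma exists_eq_triple {e : Finset ℕ} (h : e.card = 3) {x : ℕ} (hx : x ∈ e) :
    ∃ y z, e = {x, y, z} := by
  have h2 : (e.erase x).card = 2 := by rw [Finset.card_erase_of_mem hx, h]
  obtain ⟨y, z, -, hyz⟩ := Finset.card_eq_two.1 h2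
  exact ⟨y, z, by rw [← hyz, Finset.insert_erase hx]⟩

lemma swap_mem {a b c : ℕ} (h : {a, b, c} ∈ S) : {b, a, c} ∈ S := by
  rwa [Finset.insert_comm]

lemma flip_mem {a b c : ℕ} (h : {a, b, c} ∈ S) : {a, c, b} ∈ S := by
  rwa [Finset.pair_comm]

lemma rotate_mem {a b c : ℕ} (h : {a, b, c} ∈ S) : {b, c, a} ∈ S := flip_mem (swap_mem h)

lemma exists_eq_triple_of_two {e : Finset ℕ} (h : e.card = 3) {x y : ℕ} (hx : x ∈ e) (hy : y ∈ e)
    (hxy : x ≠ y) : ∃ z, e = {x, y, z} := by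
  obtain ⟨s, t, rfl⟩ := exists_eq_triple h hx
  simp only [Finset.mem_insert, Finset.mem_singleton] at hy
  rcases hy with rfl | rfl | rfl
  · exact absurd rfl hxy
  · exact ⟨t, rfl⟩
  · exact ⟨s, by rw [Finset.pair_comm]⟩

lemma Deficient.ne (hD : Deficient F S) {a b c : ℕ} (h : {a, b, c} ∈ S) : a ≠ b ∧ a ≠ c ∧ b ≠ c :=
  ne_of_card_triple (hD.card h)

lemma Deficient.false_of_path_or_triangle (hD : Deficient F S) {v x a b s : ℕ} (hab : a ≠ b)
    (h1 : {v, x, a} ∈ S) (h2 : {v, x, b} ∈ S) (h3 : {v, a, s} ∈ S) (hsx : s ≠ x) : False := by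
  obtain ⟨h12, h13, h23⟩ := hD.ne h1
  obtain ⟨-, h15, h25⟩ := hD.ne h2
  obtain ⟨-, h16, h36⟩ := hD.ne h3
  by_cases hsb : s = b
  · subst hsb
    exact hD.false_of_triangle (a := v) (b := x) (c := a) (d := s) (by simp; grind) h1 h2 h3
  · exact hD.false_of_path (a := v) (b := b) (c := x) (d := a) (e := s) (by simp; grind)
      (flip_mem h2) h1 h3

lemma Deficient.false_of_two_common (hD : Deficient F S) {v x a b s t : ℕ} (hab : a ≠ b)
    (h1 : {v, x, a} ∈ S) (h2 : {v, x, b} ∈ S) (h3 : {v, s, t} ∈ S)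
    (h31 : ({v, s, t} : Finset ℕ) ≠ {v, x, a}) (h32 : ({v, s, t} : Finset ℕ) ≠ {v, x, b}) :
    False := by
  obtain ⟨h12, h13, h23⟩ := hD.ne h1
  obtain ⟨-, h15, h25⟩ := hD.ne h2
  obtain ⟨h16, h17, h67⟩ := hD.ne h3
  by_cases hsx : s = x
  · subst hsx
    have hta : t ≠ a := by rintro rfl; exact h31 rfl
    have htb : t ≠ b := by rintro rfl; exact h32 rfl
    exact hD.false_of_star (a := v) (b := s) (c := a) (d := b) (e := t) (by simp; grind) h1 h2 h3
  by_cases htx : t = x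
  · subst htx
    have hta : s ≠ a := by rintro rfl; exact h31 (by rw [Finset.pair_comm])
    have htb : s ≠ b := by rintro rfl; exact h32 (by rw [Finset.pair_comm])
    exact hD.false_of_star (a := v) (b := t) (c := a) (d := b) (e := s) (by simp; grind) h1 h2
      (flip_mem h3)
  by_cases hsa : s = a
  · subst hsa; exact hD.false_of_path_or_triangle hab h1 h2 h3 htx
  by_cases hta : t = a
  · subst hta; exact hD.false_of_path_or_triangle hab h1 h2 (flip_mem h3) hsx
  by_cases hsb : s = b
  · subst hsb; exact hD.false_of_path_or_triangle hab.symm h2 h1 h3 htx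
  by_cases htb : t = b
  · subst htb; exact hD.false_of_path_or_triangle hab.symm h2 h1 (flip_mem h3) hsx
  exact hD.false_of_cherry (a := v) (b := x) (c := a) (d := b) (e := s) (f := t) (by simp; grind)
    h1 h2 h3

lemma Deficient.false_of_common (hD : Deficient F S) {e f g : Finset ℕ} (he : e ∈ S) (hf : f ∈ S)
    (hg : g ∈ S) {v x : ℕ} (hvx : v ≠ x) (hve : v ∈ e) (hvf : v ∈ f) (hvg : v ∈ g) (hxe : x ∈ e)
    (hxf : x ∈ f) (hef : e ≠ f) (heg : e ≠ g) (hfg : f ≠ g) : False := by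
  obtain ⟨a, rfl⟩ := exists_eq_triple_of_two (hD.card he) hve hxe hvx
  obtain ⟨b, rfl⟩ := exists_eq_triple_of_two (hD.card hf) hvf hxf hvx
  obtain ⟨s, t, rfl⟩ := exists_eq_triple (hD.card hg) hvg
  exact hD.false_of_two_common (by rintro rfl; exact hef rfl) he hf hg heg.symm hfg.symm

/-- Every element lies in at most two members of `S`. -/
lemma Deficient.eq_of_mem_three (hD : Deficient F S) {e f g : Finset ℕ} (he : e ∈ S) (hf : f ∈ S)
    (hg : g ∈ S) {v : ℕ} (hve : v ∈ e) (hvf : v ∈ f) (hvg : v ∈ g) : e = f ∨ e = g ∨ f = g := by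
  by_contra! hne
  obtain ⟨hef, heg, hfg⟩ := hne
  have h1 : ∀ x, v ≠ x → x ∈ e → x ∉ f := fun x hx h h' =>
    hD.false_of_common he hf hg hx hve hvf hvg h h' hef heg hfg
  have h2 : ∀ x, v ≠ x → x ∈ e → x ∉ g := fun x hx h h' =>
    hD.false_of_common he hg hf hx hve hvg hvf h h' heg hef hfg.symm
  have h3 : ∀ x, v ≠ x → x ∈ f → x ∉ g := fun x hx h h' =>
    hD.false_of_common hf hg he hx hvf hvg hve h h' hfg hef.symm heg.symm
  obtain ⟨a, b, rfl⟩ := exists_eq_triple (hD.card he) hve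
  obtain ⟨c, d, rfl⟩ := exists_eq_triple (hD.card hf) hvf
  obtain ⟨s, t, rfl⟩ := exists_eq_triple (hD.card hg) hvg
  have := hD.ne he
  have := hD.ne hf
  have := hD.ne hg
  simp only [Finset.mem_insert, Finset.mem_singleton] at h1 h2 h3
  exact hD.false_of_matching (a := v) (b := a) (c := b) (d := c) (e := d) (f := s) (g := t)
    (by simp; grind) he hf hg

/-- All members of `S` that contain `x` are equal. -/
def Private (S : Finset (Finset ℕ)) (x : ℕ) : Prop :=
  ∀ f ∈ S, ∀ g ∈ S, x ∈ f → x ∈ g → f = g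

lemma exists_ne_of_not_private {x : ℕ} (h : ¬Private S x) (e : Finset ℕ) :
    ∃ f ∈ S, x ∈ f ∧ f ≠ e := by
  unfold Private at h
  push Not at h
  obtain ⟨f, hf, g, hg, hxf, hxg, hfg⟩ := h
  by_cases hfe : f = e
  · exact ⟨g, hg, hxg, by rintro rfl; exact hfg hfe⟩
  · exact ⟨f, hf, hxf, hfe⟩

lemma Deficient.private_of_common (hD : Deficient F S) {a b c z : ℕ} (he : {a, b, c} ∈ S)
    (hf : {a, b, z} ∈ S) (hcz : c ≠ z) (hc : ¬Private S c) : Private S z := by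
  by_contra hz
  obtain ⟨g, hg, hcg, hge⟩ := exists_ne_of_not_private hc {a, b, c}
  obtain ⟨h, hh, hzh, hhf⟩ := exists_ne_of_not_private hz {a, b, z}
  have hef : ({a, b, c} : Finset ℕ) ≠ {a, b, z} := by
    intro h'
    have : c ∈ ({a, b, z} : Finset ℕ) := h' ▸ by simp
    have := hD.ne he
    simp at *; grind
  have hne := hD.ne he
  have hnf := hD.ne hf
  have key : ∀ k ∈ S, k ≠ {a, b, c} → k ≠ {a, b, z} → a ∉ k ∧ b ∉ k := by
    refine fun k hk h1 h2 => ⟨fun hak => ?_, fun hbk => ?_⟩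
    · have := hD.eq_of_mem_three he hf hk (v := a) (by simp) (by simp) hak
      grind
    · have := hD.eq_of_mem_three he hf hk (v := b) (by simp) (by simp) hbk
      grind
  have hgf : g ≠ {a, b, z} := by rintro rfl; simp at hcg; grind
  have hhe : h ≠ {a, b, c} := by rintro rfl; simp at hzh; grind
  have hgk := key g hg hge hgf
  have hhk := key h hh hhe hhf
  by_cases hzg : z ∈ g
  · obtain ⟨w, rfl⟩ := exists_eq_triple_of_two (hD.card hg) hcg hzg hcz
    have := hD.ne hg
    simp only [Finset.mem_insert, Finset.mem_singleton] at hgk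
    exact hD.false_of_kite (a := a) (b := b) (c := c) (d := z) (e := w) (by simp; grind) he hf hg
  have hch : c ∉ h := fun hch => by
    rcases hD.eq_of_mem_three he hg hh (v := c) (by simp) hcg hch with h' | h' | h'
    · exact hge h'.symm
    · exact hhe h'.symm
    · exact hzg (h' ▸ hzh)
  obtain ⟨s, t, rfl⟩ := exists_eq_triple (hD.card hg) hcg
  obtain ⟨u, w, rfl⟩ := exists_eq_triple (hD.card hh) hzh
  have hng := hD.ne hg
  have hnh := hD.ne hh
  simp only [Finset.mem_insert, Finset.mem_singleton] at hgk hhk hzg hch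
  by_cases hsu : s = u
  · subst hsu
    by_cases htw : t = w
    · subst htw
      exact hD.false_of_doubleFork (a := a) (b := b) (c := c) (d := z) (e := s) (f := t)
        (by simp; grind) he hf hg hh
    exact hD.false_of_meetingFork (a := a) (b := b) (c := c) (d := z) (e := t) (f := s) (g := w)
      (by simp; grind) he hf (flip_mem hg) hh
  by_cases hsw : s = w
  · subst hsw
    by_cases htu : t = u
    · subst htu
      exact hD.false_of_doubleFork (a := a) (b := b) (c := c) (d := z) (e := s) (f := t)
        (by simp; grind) he hf hg (flip_mem hh)
    exact hD.false_of_meetingFork (a := a) (b := b) (c := c) (d := z) (e := t) (f := s) (g := u)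
      (by simp; grind) he hf (flip_mem hg) (flip_mem hh)
  by_cases htu : t = u
  · subst htu
    exact hD.false_of_meetingFork (a := a) (b := b) (c := c) (d := z) (e := s) (f := t) (g := w)
      (by simp; grind) he hf hg hh
  by_cases htw : t = w
  · subst htw
    exact hD.false_of_meetingFork (a := a) (b := b) (c := c) (d := z) (e := s) (f := t) (g := u)
      (by simp; grind) he hf hg (flip_mem hh)
  exact hD.false_of_disjointFork (a := a) (b := b) (c := c) (d := z) (e := s) (f := t) (g := u)
    (h := w) (by simp; grind) he hf hg hh

lemma Deficient.false_of_meeting_neighbours (hD : Deficient F S) {a b c x : ℕ} {f g : Finset ℕ}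
    (he : {a, b, c} ∈ S) (hf : f ∈ S) (hg : g ∈ S) (haf : a ∈ f) (hbg : b ∈ g) (hbf : b ∉ f)
    (hcf : c ∉ f) (hag : a ∉ g) (hcg : c ∉ g) (hxf : x ∈ f) (hxg : x ∈ g) : False := by
  have hne := hD.ne he
  have hxa : a ≠ x := by rintro rfl; exact hag hxg
  have hxb : b ≠ x := by rintro rfl; exact hbf hxf
  have hxc : c ≠ x := by rintro rfl; exact hcf hxf
  obtain ⟨u, rfl⟩ := exists_eq_triple_of_two (hD.card hf) haf hxf hxa
  obtain ⟨w, rfl⟩ := exists_eq_triple_of_two (hD.card hg) hbg hxg hxb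
  have := hD.ne hf
  have := hD.ne hg
  simp only [Finset.mem_insert, Finset.mem_singleton] at hbf hcf hag hcg
  by_cases huw : u = w
  · subst huw
    exact hD.false_of_kite (a := x) (b := u) (c := a) (d := b) (e := c) (by simp; grind)
      (rotate_mem hf) (rotate_mem hg) he
  · exact hD.false_of_looseTriangle (a := a) (b := c) (c := b) (d := w) (e := x) (f := u)
      (by simp; grind) (flip_mem he) (flip_mem hg) hf

lemma Deficient.exists_partner (hD : Deficient F S) {e : Finset ℕ} (he : e ∈ S)
    (hfull : ∀ x ∈ e, ¬Private S x) :
    ∃ p q r z, e = {p, q, r} ∧ {p, q, z} ∈ S ∧ z ∉ e ∧ Private S z := by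
  have key : ∀ p q r, e = {p, q, r} → ∀ f ∈ S, f ≠ e → p ∈ f → q ∈ f →
      ∃ p q r z, e = {p, q, r} ∧ {p, q, z} ∈ S ∧ z ∉ e ∧ Private S z := by
    intro p q r h f hf hfe hpf hqf
    subst h
    have hne := hD.ne he
    obtain ⟨z, rfl⟩ := exists_eq_triple_of_two (hD.card hf) hpf hqf hne.1
    have hnf := hD.ne hf
    have hrz : r ≠ z := by rintro rfl; exact hfe rfl
    exact ⟨p, q, r, z, rfl, hf, by simp; grind,
      hD.private_of_common he hf hrz (hfull r (by simp))⟩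
  obtain ⟨a, b, c, -, -, -, h⟩ := Finset.card_eq_three.1 (hD.card he)
  obtain ⟨f, hf, haf, hfe⟩ := exists_ne_of_not_private (hfull a (by simp [h])) e
  obtain ⟨g, hg, hbg, hge⟩ := exists_ne_of_not_private (hfull b (by simp [h])) e
  obtain ⟨k, hk, hck, hke⟩ := exists_ne_of_not_private (hfull c (by simp [h])) e
  have hacb : e = {a, c, b} := by rw [h, Finset.pair_comm]
  have hbca : e = {b, c, a} := by rw [h, Finset.insert_comm, Finset.pair_comm a c]
  by_cases hbf : b ∈ f
  · exact key a b c h f hf hfe haf hbf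
  by_cases hcf : c ∈ f
  · exact key a c b hacb f hf hfe haf hcf
  by_cases hag : a ∈ g
  · exact key a b c h g hg hge hag hbg
  by_cases hcg : c ∈ g
  · exact key b c a hbca g hg hge hbg hcg
  by_cases hak : a ∈ k
  · exact key a c b hacb k hk hke hak hck
  by_cases hbk : b ∈ k
  · exact key b c a hbca k hk hke hbk hck
  exfalso
  subst h
  have h1 : ∀ x ∈ f, x ∉ g := fun x hx hx' =>
    hD.false_of_meeting_neighbours he hf hg haf hbg hbf hcf hag hcg hx hx'
  have h2 : ∀ x ∈ f, x ∉ k := fun x hx hx' =>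
    hD.false_of_meeting_neighbours (flip_mem he) hf hk haf hck hcf hbf hak hbk hx hx'
  have h3 : ∀ x ∈ g, x ∉ k := fun x hx hx' =>
    hD.false_of_meeting_neighbours (rotate_mem he) hg hk hbg hck hcg hag hbk hak hx hx'
  obtain ⟨s, t, rfl⟩ := exists_eq_triple (hD.card hf) haf
  obtain ⟨u, w, rfl⟩ := exists_eq_triple (hD.card hg) hbg
  obtain ⟨x, y, rfl⟩ := exists_eq_triple (hD.card hk) hck
  have := hD.ne he
  have := hD.ne hf
  have := hD.ne hg
  have := hD.ne hk
  simp only [Finset.mem_insert, Finset.mem_singleton] at h1 h2 h3 hbf hcf hag hcg hak hbk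
  exact hD.false_of_tripod (a := a) (b := b) (c := c) (d := s) (e := t) (f := u) (g := w) (h := x)
    (i := y) (by simp; grind) he hf hg hk

/-- The edges in `R` remain to be explored by a walk that has just left the edge `c` and can only be
continued at the element `q`. -/
structure Walk (S R : Finset (Finset ℕ)) (q : ℕ) (c : Finset ℕ) : Prop where
  sub : R ⊆ S
  last_mem : c ∈ S
  last_notMem : c ∉ R
  mem_last : q ∈ c
  next : ∃ f ∈ R, q ∈ f
  closed : ∀ f ∈ R, ∀ v ∈ f, v ≠ q → ∀ d ∈ S, v ∈ d → d ∈ R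

lemma Walk.notMem {q : ℕ} {c d f : Finset ℕ} (hw : Walk S R q c) (hd : d ∈ S) (hdR : d ∉ R)
    (hf : f ∈ R) {v : ℕ} (hv : v ∈ f) (hvq : v ≠ q) : v ∉ d :=
  fun hvd => hdR (hw.closed f hf v hv hvq d hd hvd)

lemma Walk.pass (hD : Deficient F S) {q h i : ℕ} {c : Finset ℕ} (hw : Walk S R q c)
    (hf : {q, h, i} ∈ R) (hh : Private S h) (hi : ¬Private S i) :
    Walk S (R.erase {q, h, i}) i {q, h, i} := by
  have hfS := hw.sub hf
  have hne := hD.ne hfS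
  refine ⟨(Finset.erase_subset _ _).trans hw.sub, hfS, Finset.notMem_erase _ _, by simp, ?_, ?_⟩
  · obtain ⟨g, hg, hig, hgf⟩ := exists_ne_of_not_private hi {q, h, i}
    exact ⟨g, Finset.mem_erase.2 ⟨hgf, hw.closed _ hf i (by simp) hne.2.1.symm g hg hig⟩, hig⟩
  · intro g hg v hv hvi d hd hvd
    obtain ⟨hgf, hgR⟩ := Finset.mem_erase.1 hg
    have hvq : v ≠ q := by
      rintro rfl
      rcases hD.eq_of_mem_three hw.last_mem hfS (hw.sub hgR) hw.mem_last (by simp) hv with h' | h' | h'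
      · exact hw.last_notMem (h' ▸ hf)
      · exact hw.last_notMem (h' ▸ hgR)
      · exact hgf h'.symm
    refine Finset.mem_erase.2 ⟨?_, hw.closed g hgR v hv hvq d hd hvd⟩
    rintro rfl
    simp only [Finset.mem_insert, Finset.mem_singleton] at hvd
    rcases hvd with h' | rfl | h'
    · exact hvq h'
    · exact hgf (hh _ (hw.sub hgR) _ hfS hv (by simp))
    · exact hvi h'

lemma Walk.step (hD : Deficient F S)
    (hP : ∀ e ∈ S, ∀ x ∈ e, ∀ y ∈ e, x ≠ y → Private S x → ¬Private S y)
    {q : ℕ} {c : Finset ℕ} (hw : Walk S R q c) :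
    ∃ h i, {q, h, i} ∈ R ∧
      ((∃ z, z ≠ q ∧ {h, i, z} ∈ R) ∨ Walk S (R.erase {q, h, i}) i {q, h, i}) := by
  obtain ⟨f, hf, hqf⟩ := hw.next
  have hfS := hw.sub hf
  by_cases hfull : ∀ x ∈ f, ¬Private S x
  · obtain ⟨p, r, s, z, rfl, hz, hzf, hzp⟩ := hD.exists_partner hfS hfull
    have hne := hD.ne hfS
    have hcf : c ≠ {p, r, s} := by rintro rfl; exact hw.last_notMem hf
    have hfz : ({p, r, s} : Finset ℕ) ≠ {p, r, z} := by
      intro h'; rw [h'] at hzf; simp at hzf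
    have hzq : z ≠ q := by rintro rfl; exact hzf hqf
    have hqz : q ∈ ({p, r, z} : Finset ℕ) → c = {p, r, z} := fun hq => by
      rcases hD.eq_of_mem_three hw.last_mem hfS hz hw.mem_last hqf hq with h' | h' | h'
      · exact absurd h' hcf
      · exact h'
      · exact absurd h' hfz
    simp only [Finset.mem_insert, Finset.mem_singleton] at hqf
    rcases hqf with rfl | rfl | rfl
    · have hc := hqz (by simp)
      exact absurd (show r ∈ c by simp [hc])
        (hw.notMem hw.last_mem hw.last_notMem hf (by simp) hne.1.symm)
    · have hc := hqz (by simp)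
      exact absurd (show p ∈ c by simp [hc])
        (hw.notMem hw.last_mem hw.last_notMem hf (by simp) hne.1)
    · exact ⟨p, r, rotate_mem (rotate_mem hf), .inl ⟨z, hzq,
        hw.closed _ hf p (by simp) hne.2.1 _ hz (by simp)⟩⟩
  · push Not at hfull
    obtain ⟨h, hhf, hh⟩ := hfull
    have hqp : ¬Private S q := fun hq =>
      hw.last_notMem ((hq _ hw.last_mem _ hfS hw.mem_last hqf) ▸ hf)
    have hqh : q ≠ h := by rintro rfl; exact hqp hh
    obtain ⟨i, rfl⟩ := exists_eq_triple_of_two (hD.card hfS) hqf hhf hqh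
    exact ⟨h, i, hf, .inr (hw.pass hD hf hh
      (hP _ hfS h (by simp) i (by simp) (hD.ne hfS).2.2 hh))⟩

lemma Walk.false_of_tailSum_pos (hD : Deficient F S)
    (hP : ∀ e ∈ S, ∀ x ∈ e, ∀ y ∈ e, x ≠ y → Private S x → ¬Private S y)
    {a b c d e : ℕ} (hw : Walk S R e {c, d, e}) (h1 : {a, b, c} ∈ S) (h1R : {a, b, c} ∉ R)
    (hv : [a, b, c, d, e].Nodup) (hpos : 0 < tailSum F [a, b, c, d, e]) : False := by
  induction R using Finset.strongInduction generalizing a b c d e with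
  | H R ih =>
    have h2 := hw.last_mem
    have hout : ∀ f ∈ R, ∀ x ∈ f, x ≠ e → x ≠ a ∧ x ≠ b ∧ x ≠ c ∧ x ≠ d := fun f hf x hx hxe => by
      have k1 := hw.notMem h1 h1R hf hx hxe
      have k2 := hw.notMem h2 hw.last_notMem hf hx hxe
      simp only [Finset.mem_insert, Finset.mem_singleton] at k1 k2
      tauto
    obtain ⟨h, i, hf, hcase⟩ := hw.step hD hP
    have hfS := hw.sub hf
    have hne := hD.ne hfS
    have kh := hout _ hf h (by simp) hne.1.symm
    have ki := hout _ hf i (by simp) hne.2.1.symm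
    rcases hcase with ⟨z, hze, hz⟩ | hw'
    · have kz := hout _ hz z (by simp) hze
      have hnz := hD.ne (hw.sub hz)
      have := hD.tailSum_pos_of_head (a := h) (b := i) (c := z) (d := e) (e := d) (f := c) (g := b)
        (h := a) (by simp at hv ⊢; grind) (hw.sub hz) (rotate_mem hfS)
        (flip_mem (rotate_mem (rotate_mem h2))) (flip_mem (rotate_mem (rotate_mem h1)))
      rw [tailSum_reverse] at this
      linarith
    · have hlt := hD.tailSum_lt_of_link (a := a) (b := b) (c := c) (d := d) (e := e) (f := h)
        (g := i) (by simp at hv ⊢; grind) h1 h2 hfS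
      exact ih _ (Finset.erase_ssubset hf) hw' h2
        (fun hm => hw.last_notMem (Finset.mem_of_mem_erase hm)) (by simp at hv ⊢; grind)
        (hpos.trans hlt)

lemma Deficient.false_of_full (hD : Deficient F S)
    (hP : ∀ e ∈ S, ∀ x ∈ e, ∀ y ∈ e, x ≠ y → Private S x → ¬Private S y)
    {e : Finset ℕ} (he : e ∈ S) (hfull : ∀ x ∈ e, ¬Private S x) : False := by
  obtain ⟨a, b, p, x, rfl, hf, hxe, hx⟩ := hD.exists_partner he hfull
  have hne := hD.ne he
  have hnf := hD.ne hf
  simp only [Finset.mem_insert, Finset.mem_singleton] at hxe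
  have hef : ({a, b, p} : Finset ℕ) ≠ {a, b, x} := by
    intro h'
    have : x ∈ ({a, b, p} : Finset ℕ) := h' ▸ by simp
    simp at this; grind
  have hw : Walk S ((S.erase {a, b, p}).erase {a, b, x}) p {a, b, p} := by
    refine ⟨(Finset.erase_subset _ _).trans (Finset.erase_subset _ _), he, by simp, by simp, ?_, ?_⟩
    · obtain ⟨g, hg, hpg, hge⟩ := exists_ne_of_not_private (hfull p (by simp)) {a, b, p}
      have hgx : g ≠ {a, b, x} := by
        rintro rfl
        simp at hpg; grind
      exact ⟨g, Finset.mem_erase.2 ⟨hgx, Finset.mem_erase.2 ⟨hge, hg⟩⟩, hpg⟩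
    · intro g hg v hv hvp d hd hvd
      simp only [Finset.mem_erase] at hg ⊢
      have hvab : v ≠ a ∧ v ≠ b := by
        constructor <;> rintro rfl <;>
        · have := hD.eq_of_mem_three he hf hg.2.2 (v := v) (by simp) (by simp) hv
          grind
      have hvx : v ≠ x := by
        rintro rfl
        exact hg.1 (hx _ hg.2.2 _ hf hv (by simp))
      refine ⟨?_, ?_, hd⟩
      · rintro rfl; simp at hvd; tauto
      · rintro rfl; simp at hvd; tauto
  set R := (S.erase {a, b, p}).erase {a, b, x} with hR
  have heR : {a, b, p} ∉ R := hw.last_notMem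
  have hfR : {a, b, x} ∉ R := Finset.notMem_erase _ _
  have hout : ∀ f ∈ R, ∀ y ∈ f, y ≠ p → y ≠ a ∧ y ≠ b ∧ y ≠ x := fun g hg y hy hyp => by
    have k1 := hw.notMem he heR hg hy hyp
    have k2 := hw.notMem hf hfR hg hy hyp
    simp only [Finset.mem_insert, Finset.mem_singleton] at k1 k2
    tauto
  obtain ⟨h, i, hg, hcase⟩ := hw.step hD hP
  have hgS := hw.sub hg
  have hng := hD.ne hgS
  have kh := hout _ hg h (by simp) hng.1.symm
  have ki := hout _ hg i (by simp) hng.2.1.symm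
  rcases hcase with ⟨z, hzp, hz⟩ | hw'
  · have kz := hout _ hz z (by simp) hzp
    have hnz := hD.ne (hw.sub hz)
    exact hD.false_of_shortChain (a := a) (b := b) (c := x) (d := p) (e := h) (f := i) (g := z)
      (by simp; grind) hf he hgS (hw.sub hz)
  set R' := R.erase {p, h, i} with hR'
  have hsub : R' ⊆ R := Finset.erase_subset _ _
  have hgR' : {p, h, i} ∉ R' := Finset.notMem_erase _ _
  have hout' : ∀ f ∈ R', ∀ y ∈ f, y ≠ i →
      y ≠ a ∧ y ≠ b ∧ y ≠ x ∧ y ≠ p ∧ y ≠ h := fun g' hg' y hy hyi => by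
    have k1 := hw'.notMem he (fun h' => heR (hsub h')) hg' hy hyi
    have k2 := hw'.notMem hf (fun h' => hfR (hsub h')) hg' hy hyi
    have k3 := hw'.notMem hgS hgR' hg' hy hyi
    simp only [Finset.mem_insert, Finset.mem_singleton] at k1 k2 k3
    tauto
  obtain ⟨j, k, hk, hcase'⟩ := hw'.step hD hP
  have hkS := hw'.sub hk
  have hnk := hD.ne hkS
  have kj := hout' _ hk j (by simp) hnk.1.symm
  have kk := hout' _ hk k (by simp) hnk.2.1.symm
  rcases hcase' with ⟨z, hzp, hz⟩ | hw''
  · have kz := hout' _ hz z (by simp) hzp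
    have hnz := hD.ne (hw'.sub hz)
    exact hD.false_of_longChain (a := a) (b := b) (c := x) (d := p) (e := h) (f := i) (g := j)
      (h := k) (i := z) (by simp; grind) hf he hgS hkS (hw'.sub hz)
  · have hpos := hD.tailSum_pos_of_head (a := a) (b := b) (c := x) (d := p) (e := h) (f := i)
      (g := j) (h := k) (by simp; grind) hf he hgS hkS
    exact hw''.false_of_tailSum_pos hD hP hgS (fun h' => hgR' (Finset.mem_of_mem_erase h'))
      (by simp; grind) hpos

lemma Deficient.mono {S' : Finset (Finset ℕ)} (hD : Deficient F S) (h : S' ⊆ S) :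
    Deficient F S' :=
  ⟨hD.uc, fun _ he => hD.sub (h he), fun _ he => hD.card (h he), fun _ he => hD.neg (h he)⟩

lemma Deficient.two_mul_card_le (hD : Deficient F S) : 2 * S.card ≤ (S.sup id).card := by
  induction S using Finset.strongInduction with
  | H S ih =>
    by_cases hP : ∀ e ∈ S, ∀ x ∈ e, ∀ y ∈ e, x ≠ y → Private S x → ¬Private S y
    swap
    · push Not at hP
      obtain ⟨e, he, x, hx, y, hy, hxy, hpx, hpy⟩ := hP
      have h1 := ih _ (Finset.erase_ssubset he) (hD.mono (Finset.erase_subset _ _))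
      have h2 : (S.erase e).sup id ⊆ ((S.sup id).erase x).erase y := by
        intro v hv
        obtain ⟨f, hf, hvf⟩ := Finset.mem_sup.1 hv
        obtain ⟨hfe, hfS⟩ := Finset.mem_erase.1 hf
        simp only [Finset.mem_erase]
        refine ⟨?_, ?_, Finset.mem_sup.2 ⟨f, hfS, hvf⟩⟩
        · rintro rfl; exact hfe (hpy _ hfS _ he hvf hy)
        · rintro rfl; exact hfe (hpx _ hfS _ he hvf hx)
      have h3 := Finset.card_le_card h2
      have hxU : x ∈ S.sup id := Finset.mem_sup.2 ⟨e, he, hx⟩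
      have hyU : y ∈ (S.sup id).erase x :=
        Finset.mem_erase.2 ⟨hxy.symm, Finset.mem_sup.2 ⟨e, he, hy⟩⟩
      have h4 := Finset.card_erase_add_one hxU
      have h5 := Finset.card_erase_add_one hyU
      have h6 := Finset.card_erase_add_one he
      omega
    by_cases hfull : ∃ e ∈ S, ∀ x ∈ e, ¬Private S x
    · obtain ⟨e, he, h⟩ := hfull
      exact (hD.false_of_full hP he h).elim
    push Not at hfull
    choose! x hx hpx using hfull
    have hinj : Set.InjOn x S := fun e he f hf hef => hpx e he _ he _ hf (hx e he) (hef ▸ hx f hf)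
    have hQ : S.image x ⊆ S.sup id := by
      intro v hv
      obtain ⟨e, he, rfl⟩ := Finset.mem_image.1 hv
      exact Finset.mem_sup.2 ⟨e, he, hx e he⟩
    have hdeg : ∀ a ∈ S.sup id \ S.image x, (S.filter (a ∈ ·)).card ≤ 2 := by
      intro a _
      by_contra! h
      obtain ⟨e, f, g, he, hf, hg, hef, heg, hfg⟩ := Finset.two_lt_card_iff.1 h
      simp only [Finset.mem_filter] at he hf hg
      rcases hD.eq_of_mem_three he.1 hf.1 hg.1 he.2 hf.2 hg.2 with h' | h' | h'
      exacts [hef h', heg h', hfg h']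
    have hle : ∀ e ∈ S, 2 ≤ ((S.sup id \ S.image x) ∩ e).card := by
      intro e he
      have h1 : (e.erase (x e)).card = 2 := by
        rw [Finset.card_erase_of_mem (hx e he), hD.card he]
      rw [← h1]
      refine Finset.card_le_card fun v hv => ?_
      obtain ⟨hvx, hve⟩ := Finset.mem_erase.1 hv
      refine Finset.mem_inter.2 ⟨Finset.mem_sdiff.2 ⟨Finset.mem_sup.2 ⟨e, he, hve⟩, ?_⟩, hve⟩
      intro hv'
      obtain ⟨f, hf, rfl⟩ := Finset.mem_image.1 hv'
      exact hvx (by rw [hpx f hf _ hf _ he (hx f hf) hve])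
    have h1 := Finset.sum_card_inter_le hdeg
    have h2 := Finset.card_nsmul_le_sum S _ 2 hle
    rw [Finset.card_sdiff_of_subset hQ, Finset.card_image_of_injOn hinj] at h1
    have h3 := Finset.card_le_card hQ
    rw [Finset.card_image_of_injOn hinj] at h3
    simp only [smul_eq_mul] at h2
    omega

end Deficient

lemma excess_union {F G : Finset (Finset ℕ)} (h : Disjoint F G) (i : ℕ) :
    excess (F ∪ G) i = excess F i + excess G i :=
  Finset.sum_union h

lemma excess_image {F : Finset (Finset ℕ)} {φ : Finset ℕ → Finset ℕ} (hφ : Set.InjOn φ F)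
    {i j : ℕ} (h : ∀ A ∈ F, j ∈ φ A ↔ i ∈ A) : excess (F.image φ) j = excess F i := by
  rw [excess, Finset.sum_image hφ]
  exact Finset.sum_congr rfl fun A hA => by simp only [h A hA]

lemma excess_powerset {V : Finset ℕ} {i : ℕ} (hi : i ∈ V) : excess V.powerset i = 0 := by
  have h : Disjoint (V.erase i).powerset ((V.erase i).powerset.image (insert i)) := by
    refine Finset.disjoint_left.2 fun A hA hA' => ?_
    obtain ⟨B, -, rfl⟩ := Finset.mem_image.1 hA'
    exact Finset.notMem_erase i V (Finset.mem_powerset.1 hA (Finset.mem_insert_self i B))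
  have hi' : ∀ A ∈ (V.erase i).powerset, i ∉ A := fun A hA hiA =>
    Finset.notMem_erase i V (Finset.mem_powerset.1 hA hiA)
  have hinj : Set.InjOn (insert i) ((V.erase i).powerset : Set (Finset ℕ)) := fun A hA B hB hAB =>
    by
    rw [← Finset.erase_insert (hi' A hA), ← Finset.erase_insert (hi' B hB)]
    exact congrArg (Finset.erase · i) hAB
  rw [← Finset.insert_erase hi, Finset.powerset_insert, excess_union h, excess, excess,
    Finset.sum_image hinj, ← Finset.sum_add_distrib]
  refine Finset.sum_eq_zero fun A hA => ?_
  simp [hi' A hA]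

/-- Families `B j` on a ground set `V`, all stable under union with the members of `D`, assemble
into a union-closed family whose excess on `V` is the total excess of the `B j` and `D`: each `B j`
is tagged with all but one of a set of new points. -/
lemma exists_deficient {V : Finset ℕ} {N : ℕ} (hN : 2 ≤ N) {B : Fin N → Finset (Finset ℕ)}
    {D S : Finset (Finset ℕ)} (hBV : ∀ j, B j ⊆ V.powerset) (hB : ∀ j, UC (B j))
    (hBD : ∀ j, ∀ A ∈ B j, ∀ d ∈ D, A ∪ d ∈ B j) (hDV : D ⊆ V.powerset) (hD : UC D) (h0 : ∅ ∈ D)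
    (hSD : S ⊆ D) (hS : ∀ e ∈ S, e.card = 3)
    (hneg : ∀ i ∈ V, ∑ j, excess (B j) i + excess D i < 0) :
    ∃ F, Deficient F S ∧ ∅ ∈ F := by
  set x : Fin N → ℕ := fun j => V.sup id + 1 + j with hx
  have hxinj : Function.Injective x := fun j k hjk => Fin.ext (by simp only [hx] at hjk; omega)
  have hxV : ∀ j, x j ∉ V := fun j hj => by
    have : id (x j) ≤ V.sup id := Finset.le_sup hj
    simp only [hx, id] at this; omega
  set X : Finset ℕ := Finset.univ.image x with hX
  have hxX : ∀ j, x j ∈ X := fun j => Finset.mem_image_of_mem x (Finset.mem_univ j)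
  have hVX : Disjoint V X := by
    refine Finset.disjoint_right.2 fun y hy => ?_
    obtain ⟨j, -, rfl⟩ := Finset.mem_image.1 hy
    exact hxV j
  have hinter : ∀ {Y A}, Y ⊆ X → A ∈ V.powerset → (A ∪ Y) ∩ V = A ∧ (A ∪ Y) ∩ X = Y := by
    intro Y A hY hA
    have hA := Finset.mem_powerset.1 hA
    rw [Finset.union_inter_distrib_right, Finset.union_inter_distrib_right,
      Finset.inter_eq_left.2 hA, Finset.inter_eq_left.2 hY,
      Finset.disjoint_iff_inter_eq_empty.1 (hVX.mono_left hA),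
      Finset.disjoint_iff_inter_eq_empty.1 (hVX.symm.mono_left hY)]
    simp
  have hexcess : ∀ {Y G}, Y ⊆ X → G ⊆ V.powerset → ∀ i ∈ V,
      excess (G.image (· ∪ Y)) i = excess G i := by
    intro Y G hY hG i hi
    refine excess_image (fun A hA A' hA' h => ?_) fun A _ => ?_
    · rw [← (hinter hY (hG hA)).1, ← (hinter hY (hG hA')).1]
      exact congrArg (· ∩ V) h
    · have : i ∉ Y := fun h => Finset.disjoint_left.1 hVX hi (hY h)
      simp [this]
  set P := V.powerset.image (· ∪ X) with hP
  set Q : Fin N → Finset (Finset ℕ) := fun j => (B j).image (· ∪ X.erase (x j)) with hQ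
  have tagP : ∀ A ∈ P, A ∩ X = X := by
    intro A hA
    obtain ⟨A', hA', rfl⟩ := Finset.mem_image.1 hA
    exact (hinter subset_rfl hA').2
  have tagQ : ∀ j, ∀ A ∈ Q j, A ∩ X = X.erase (x j) := by
    intro j A hA
    obtain ⟨A', hA', rfl⟩ := Finset.mem_image.1 hA
    exact (hinter (Finset.erase_subset _ _) (hBV j hA')).2
  have tagD : ∀ A ∈ D, A ∩ X = ∅ := fun A hA =>
    Finset.disjoint_iff_inter_eq_empty.1 (hVX.mono_left (Finset.mem_powerset.1 (hDV hA)))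
  have erase_ne : ∀ j, X.erase (x j) ≠ X := fun j h =>
    Finset.notMem_erase (x j) X (h.symm ▸ hxX j)
  have erase_inj : ∀ j k, X.erase (x j) = X.erase (x k) → j = k := fun j k h => by
    by_contra hjk
    exact Finset.notMem_erase (x j) X
      (h ▸ Finset.mem_erase.2 ⟨fun h' => hjk (hxinj h'), hxX j⟩)
  have erase_nonempty : ∀ j, X.erase (x j) ≠ ∅ := fun j h => by
    obtain ⟨k, hk⟩ : ∃ k : Fin N, k ≠ j :=
      haveI : Nontrivial (Fin N) := Fin.nontrivial_iff_two_le.2 hN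
      exists_ne j
    have : x k ∈ X.erase (x j) := Finset.mem_erase.2 ⟨fun h' => hk (hxinj h'), hxX k⟩
    simp [h] at this
  have memP : ∀ A, A ∩ X = X → A ⊆ V ∪ X → A ∈ P := fun A h1 h2 => by
    refine Finset.mem_image.2 ⟨A ∩ V, Finset.mem_powerset.2 Finset.inter_subset_right, ?_⟩
    conv_lhs => rw [← h1]
    rw [← Finset.inter_union_distrib_left, Finset.inter_eq_left.2 h2]
  set F := (P ∪ Finset.univ.biUnion Q) ∪ D with hF
  have hsubF : ∀ A ∈ F, A ⊆ V ∪ X := by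
    intro A hA
    simp only [hF, Finset.mem_union, Finset.mem_biUnion, Finset.mem_univ, true_and] at hA
    rcases hA with (hA | ⟨j, hA⟩) | hA
    · obtain ⟨A', hA', rfl⟩ := Finset.mem_image.1 hA
      exact Finset.union_subset_union (Finset.mem_powerset.1 hA') subset_rfl
    · obtain ⟨A', hA', rfl⟩ := Finset.mem_image.1 hA
      exact Finset.union_subset_union (Finset.mem_powerset.1 (hBV j hA')) (Finset.erase_subset _ _)
    · exact (Finset.mem_powerset.1 (hDV hA)).trans Finset.subset_union_left
  have hPF : P ⊆ F := Finset.subset_union_left.trans Finset.subset_union_left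
  have hQF : ∀ j, Q j ⊆ F := fun j =>
    (Finset.subset_biUnion_of_mem Q (Finset.mem_univ j)).trans
      (Finset.subset_union_right.trans Finset.subset_union_left)
  have hDF : D ⊆ F := Finset.subset_union_right
  have hPu : ∀ A ∈ P, ∀ C ∈ F, A ∪ C ∈ F := fun A hA C hC => by
    refine hPF (memP _ ?_ (Finset.union_subset (hsubF A (hPF hA)) (hsubF C hC)))
    rw [Finset.union_inter_distrib_right, tagP A hA, Finset.union_eq_left]
    exact Finset.inter_subset_right
  have hQD : ∀ j, ∀ A ∈ Q j, ∀ d ∈ D, A ∪ d ∈ F := fun j A hA d hd => by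
    obtain ⟨A', hA', rfl⟩ := Finset.mem_image.1 hA
    rw [Finset.union_right_comm]
    exact hQF j (Finset.mem_image_of_mem _ (hBD j A' hA' d hd))
  have hFuc : UC F := by
    intro A hA C hC
    have hA' := hA
    have hC' := hC
    simp only [hF, Finset.mem_union, Finset.mem_biUnion, Finset.mem_univ, true_and] at hA' hC'
    rcases hA' with (hA' | ⟨j, hA'⟩) | hA'
    · exact hPu A hA' C hC
    · rcases hC' with (hC' | ⟨k, hC'⟩) | hC'
      · rw [Finset.union_comm]; exact hPu C hC' A hA
      · by_cases hjk : j = k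
        · subst hjk
          obtain ⟨A₀, hA₀, rfl⟩ := Finset.mem_image.1 hA'
          obtain ⟨C₀, hC₀, rfl⟩ := Finset.mem_image.1 hC'
          rw [← Finset.union_union_distrib_right]
          exact hQF j (Finset.mem_image_of_mem _ (hB j A₀ hA₀ C₀ hC₀))
        · refine hPF (memP _ ?_ (Finset.union_subset (hsubF A hA) (hsubF C hC)))
          rw [Finset.union_inter_distrib_right, tagQ j A hA', tagQ k C hC']
          ext y
          have : x j ≠ x k := fun h => hjk (hxinj h)
          simp only [Finset.mem_union, Finset.mem_erase]
          grind
      · exact hQD j A hA' C hC'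
    · rcases hC' with (hC' | ⟨k, hC'⟩) | hC'
      · rw [Finset.union_comm]; exact hPu C hC' A hA
      · rw [Finset.union_comm]; exact hQD k C hC' A hA'
      · exact hDF (hD A hA' C hC')
  have dPQ : Disjoint P (Finset.univ.biUnion Q) := by
    refine Finset.disjoint_left.2 fun A hA hA' => ?_
    obtain ⟨j, -, hj⟩ := Finset.mem_biUnion.1 hA'
    exact erase_ne j ((tagQ j A hj).symm.trans (tagP A hA))
  have dPQD : Disjoint (P ∪ Finset.univ.biUnion Q) D := by
    refine Finset.disjoint_left.2 fun A hA hA' => ?_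
    rcases Finset.mem_union.1 hA with hA | hA
    · have h := (tagP A hA).symm.trans (tagD A hA')
      exact erase_nonempty ⟨0, by omega⟩ (by rw [h]; simp)
    · obtain ⟨j, -, hj⟩ := Finset.mem_biUnion.1 hA
      exact erase_nonempty j ((tagQ j A hj).symm.trans (tagD A hA'))
  have dQ : Set.PairwiseDisjoint (↑(Finset.univ : Finset (Fin N))) Q := by
    intro j _ k _ hjk
    exact Finset.disjoint_left.2 fun A hA hA' =>
      hjk (erase_inj j k ((tagQ j A hA).symm.trans (tagQ k A hA')))
  refine ⟨F, ⟨hFuc, fun e he => hDF (hSD he), fun e he => hS e he, fun e he i hi => ?_⟩, hDF h0⟩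
  have hiV : i ∈ V := Finset.mem_powerset.1 (hDV (hSD he)) hi
  have h1 : excess (Finset.univ.biUnion Q) i = ∑ j, excess (B j) i := by
    rw [excess, Finset.sum_biUnion dQ]
    exact Finset.sum_congr rfl fun j _ => hexcess (Finset.erase_subset _ _) (hBV j) i hiV
  rw [hF, excess_union dPQD, excess_union dPQ, h1, hP, hexcess subset_rfl subset_rfl i hiV,
    excess_powerset hiV, zero_add]
  exact hneg i hiV

/-- The subset of `{1, …, k}` described by the binary digits of `m`. -/
def digits (k m : ℕ) : Finset ℕ := (Finset.Icc 1 k).filter fun i => m.testBit (i - 1)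

lemma digits_or (k m n : ℕ) : digits k (m ||| n) = digits k m ∪ digits k n := by
  simp [digits, Finset.filter_or]

lemma digits_injOn (k : ℕ) : Set.InjOn (digits k) {m | m < 2 ^ k} := by
  intro m hm n hn h
  refine Nat.eq_of_testBit_eq fun i => ?_
  by_cases hi : i < k
  · have := congrArg (i + 1 ∈ ·) h
    simp only [digits, Finset.mem_filter, Finset.mem_Icc, Nat.add_sub_cancel] at this
    have h' : m.testBit i = true ↔ n.testBit i = true := by
      constructor <;> intro _ <;> simp_all
    exact Bool.eq_iff_iff.2 h'
  · have h2 : 2 ^ k ≤ 2 ^ i := Nat.pow_le_pow_right (by norm_num) (not_lt.1 hi)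
    rw [Nat.testBit_lt_two_pow (lt_of_lt_of_le hm h2),
      Nat.testBit_lt_two_pow (lt_of_lt_of_le hn h2)]

/-- The family of subsets of `{1, …, k}` described by the binary digits of `c`. -/
def family (k c : ℕ) : Finset (Finset ℕ) :=
  ((Finset.range (2 ^ k)).filter fun m => c.testBit m).image (digits k)

lemma mem_family {k c : ℕ} {A : Finset ℕ} :
    A ∈ family k c ↔ ∃ m < 2 ^ k, c.testBit m ∧ digits k m = A := by
  simp [family, and_assoc]

lemma family_subset (k c : ℕ) : family k c ⊆ (Finset.Icc 1 k).powerset := fun A hA => by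
  obtain ⟨m, -, -, rfl⟩ := mem_family.1 hA
  exact Finset.mem_powerset.2 (Finset.filter_subset _ _)

/-- The members described by `c` containing `i + 1`, minus the other ones. -/
def codeExcess (k c i : ℕ) : ℤ :=
  ∑ m ∈ Finset.range (2 ^ k), if c.testBit m then (if m.testBit i then 1 else -1) else 0

lemma excess_family {k c i : ℕ} (hi : i < k) : excess (family k c) (i + 1) = codeExcess k c i := by
  rw [excess, family, Finset.sum_image fun m hm n hn => digits_injOn k (by simp_all) (by simp_all),
    Finset.sum_filter, codeExcess]
  refine Finset.sum_congr rfl fun m _ => ?_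
  have : i + 1 ∈ digits k m ↔ m.testBit i := by
    simp only [digits, Finset.mem_filter, Finset.mem_Icc, Nat.add_sub_cancel]
    exact and_iff_right ⟨by omega, hi⟩
  simp only [this]

lemma family_union {k a b c : ℕ} (h : ∀ m < 2 ^ k, ∀ n < 2 ^ k, a.testBit m → b.testBit n →
      c.testBit (m ||| n)) {A B : Finset ℕ} (hA : A ∈ family k a) (hB : B ∈ family k b) :
    A ∪ B ∈ family k c := by
  obtain ⟨m, hm, ha, rfl⟩ := mem_family.1 hA
  obtain ⟨n, hn, hb, rfl⟩ := mem_family.1 hB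
  exact mem_family.2 ⟨m ||| n, Nat.or_lt_two_pow hm hn, h m hm n hn ha hb, digits_or k m n⟩

/-- Version of `exists_deficient` for families given by binary digits, with multiplicities. -/
lemma exists_deficient_of_codes (k : ℕ) (M : List (ℕ × ℕ)) (d : ℕ) {S : Finset (Finset ℕ)}
    (hM : 2 ≤ (M.map Prod.fst).sum)
    (hB : ∀ p ∈ M, ∀ m < 2 ^ k, ∀ n < 2 ^ k, p.2.testBit m → (p.2.testBit n || d.testBit n) →
      p.2.testBit (m ||| n))
    (hD : ∀ m < 2 ^ k, ∀ n < 2 ^ k, d.testBit m → d.testBit n → d.testBit (m ||| n))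
    (h0 : d.testBit 0) (hSD : S ⊆ family k d) (hS : ∀ e ∈ S, e.card = 3)
    (hneg : ∀ i < k, (M.map fun p => p.1 * codeExcess k p.2 i).sum + codeExcess k d i < 0) :
    ∃ F, Deficient F S ∧ ∅ ∈ F := by
  set L : List ℕ := M.flatMap fun p => List.replicate p.1 p.2 with hL
  have hmem : ∀ j : Fin L.length, ∃ p ∈ M, L[j] = p.2 := fun j => by
    obtain ⟨p, hp, h⟩ := List.mem_flatMap.1 (List.getElem_mem j.2)
    exact ⟨p, hp, (List.mem_replicate.1 h).2⟩
  refine exists_deficient (V := Finset.Icc 1 k) (N := L.length) (B := fun j => family k L[j])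
    (D := family k d) ?_ (fun j => family_subset k _) ?_ ?_ (family_subset k d)
    (fun A hA B hB => family_union hD hA hB)
    (mem_family.2 ⟨0, by positivity, h0, by simp [digits]⟩) hSD hS ?_
  · simpa [hL, List.length_flatMap] using hM
  · intro j A hA C hC
    obtain ⟨p, hp, h⟩ := hmem j
    simp only [h] at hA hC ⊢
    exact family_union (fun m hm n hn h1 h2 => hB p hp m hm n hn h1 (by simp [h2])) hA hC
  · intro j A hA C hC
    obtain ⟨p, hp, h⟩ := hmem j
    simp only [h] at hA ⊢
    exact family_union (fun m hm n hn h1 h2 => hB p hp m hm n hn h1 (by simp [h2])) hA hC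
  · intro i hi
    obtain ⟨i, rfl⟩ : ∃ i', i = i' + 1 := ⟨i - 1, by simp at hi; omega⟩
    have hi' : i < k := by simp at hi; omega
    have h1 : ∑ j : Fin L.length, excess (family k L[j]) (i + 1) =
        (M.map fun p => p.1 * codeExcess k p.2 i).sum := by
      simp only [excess_family hi']
      rw [← List.sum_ofFn]
      simp only [Fin.getElem_fin]
      rw [List.ofFn_getElem_eq_map L fun c => codeExcess k c i, hL, List.map_flatMap]
      simp [List.flatMap_def, List.sum_flatten, Function.comp_def]
    rw [h1, excess_family hi']
    exact hneg i hi'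

lemma exists_deficient_four : ∃ F, Deficient F {{1, 2, 3}, {1, 2, 4}} ∧ ∅ ∈ F := by
  refine exists_deficient_of_codes 4 [(2, 35071), (2, 36751), (11,
    39313)] 34945 ?_ ?_ ?_ ?_ ?_ ?_ ?_
  all_goals decide +kernel

lemma exists_deficient_six : ∃ F, Deficient F {{1, 2, 3}, {1, 2, 4}, {3, 5, 6}} ∧ ∅ ∈ F := by
  refine exists_deficient_of_codes 6 [(11, 13525360486546389939), (11, 15984926363040996821),
    (3, 17361658034195070975), (3, 17361376567808229375), (8, 18446620445484486543),
    (4, 9871759539315902719)] 9263904433501145217 ?_ ?_ ?_ ?_ ?_ ?_ ?_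
  all_goals decide +kernel

lemma Deficient.image {F S : Finset (Finset ℕ)} (hD : Deficient F S) {σ : ℕ → ℕ}
    (hσ : Function.Injective σ) :
    Deficient (F.image (Finset.image σ)) (S.image (Finset.image σ)) := by
  constructor
  · intro A hA B hB
    obtain ⟨A₀, hA₀, rfl⟩ := Finset.mem_image.1 hA
    obtain ⟨B₀, hB₀, rfl⟩ := Finset.mem_image.1 hB
    rw [← Finset.image_union]
    exact Finset.mem_image_of_mem _ (hD.uc A₀ hA₀ B₀ hB₀)
  · intro e he
    obtain ⟨e₀, he₀, rfl⟩ := Finset.mem_image.1 he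
    exact Finset.mem_image_of_mem _ (hD.sub he₀)
  · intro e he
    obtain ⟨e₀, he₀, rfl⟩ := Finset.mem_image.1 he
    rw [Finset.card_image_of_injective _ hσ, hD.card he₀]
  · intro e he i hi
    obtain ⟨e₀, he₀, rfl⟩ := Finset.mem_image.1 he
    obtain ⟨i₀, hi₀, rfl⟩ := Finset.mem_image.1 hi
    rw [excess_image (Finset.image_injective hσ).injOn fun A _ => hσ.mem_finset_image]
    exact hD.neg he₀ hi₀

lemma Deficient.union {F G S T : Finset (Finset ℕ)} (hF : Deficient F S) (hG : Deficient G T)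
    (hF0 : ∅ ∈ F) (hG0 : ∅ ∈ G) (hFG : Disjoint (F.sup id) (G.sup id)) :
    Deficient (Finset.image₂ (· ∪ ·) F G) (S ∪ T) := by
  have hinj : Set.InjOn (Function.uncurry (· ∪ · : Finset ℕ → _)) ↑(F ×ˢ G) := by
    rintro ⟨A, B⟩ hAB ⟨A', B'⟩ hAB' h
    simp only [Finset.coe_product, Set.mem_prod, Finset.mem_coe,
      Function.uncurry_apply_pair] at hAB hAB' h
    have key : ∀ {A B}, A ∈ F → B ∈ G →
        (A ∪ B) ∩ F.sup id = A ∧ (A ∪ B) ∩ G.sup id = B := by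
      intro A B hA hB
      have hA : A ≤ F.sup id := Finset.le_sup (f := id) hA
      have hB : B ≤ G.sup id := Finset.le_sup (f := id) hB
      rw [Finset.union_inter_distrib_right, Finset.union_inter_distrib_right,
        Finset.inter_eq_left.2 hA, Finset.inter_eq_left.2 hB,
        Finset.disjoint_iff_inter_eq_empty.1 (hFG.mono_left hA),
        Finset.disjoint_iff_inter_eq_empty.1 (hFG.symm.mono_left hB)]
      simp
    have h1 := key hAB.1 hAB.2
    have h2 := key hAB'.1 hAB'.2
    rw [h] at h1
    exact Prod.ext (h1.1.symm.trans h2.1) (h1.2.symm.trans h2.2)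
  have hsum : ∀ i, excess (Finset.image₂ (· ∪ ·) F G) i =
      ∑ A ∈ F, ∑ B ∈ G, if i ∈ A ∪ B then 1 else -1 := fun i => by
    rw [excess, Finset.image₂, Finset.sum_image hinj, Finset.sum_product]
    rfl
  have hout : ∀ {A B i}, A ∈ F → B ∈ G → i ∈ A → i ∉ B := fun hA hB hiA hiB =>
    Finset.disjoint_left.1 hFG (Finset.mem_sup.2 ⟨_, hA, hiA⟩) (Finset.mem_sup.2 ⟨_, hB, hiB⟩)
  refine ⟨?_, ?_, ?_, ?_⟩
  · intro A hA B hB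
    obtain ⟨A₁, hA₁, A₂, hA₂, rfl⟩ := Finset.mem_image₂.1 hA
    obtain ⟨B₁, hB₁, B₂, hB₂, rfl⟩ := Finset.mem_image₂.1 hB
    rw [Finset.union_union_union_comm]
    exact Finset.mem_image₂_of_mem (hF.uc A₁ hA₁ B₁ hB₁) (hG.uc A₂ hA₂ B₂ hB₂)
  · intro e he
    rcases Finset.mem_union.1 he with he | he
    · exact Finset.mem_image₂.2 ⟨e, hF.sub he, ∅, hG0, by simp⟩
    · exact Finset.mem_image₂.2 ⟨∅, hF0, e, hG.sub he, by simp⟩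
  · intro e he
    rcases Finset.mem_union.1 he with he | he
    exacts [hF.card he, hG.card he]
  · intro e he i hi
    rw [hsum]
    rcases Finset.mem_union.1 he with he | he
    · have : ∑ A ∈ F, ∑ B ∈ G, (if i ∈ A ∪ B then 1 else -1) = G.card * excess F i := by
        rw [excess, Finset.mul_sum]
        refine Finset.sum_congr rfl fun A hA => ?_
        rw [← nsmul_eq_mul, ← Finset.sum_const]
        refine Finset.sum_congr rfl fun B hB => ?_
        simp [hout (hF.sub he) hB hi]
      rw [this]
      exact mul_neg_of_pos_of_neg (by exact_mod_cast Finset.card_pos.2 ⟨_, hG0⟩) (hF.neg he hi)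
    · have : ∑ A ∈ F, ∑ B ∈ G, (if i ∈ A ∪ B then 1 else -1) = F.card * excess G i := by
        rw [← nsmul_eq_mul, ← Finset.sum_const]
        refine Finset.sum_congr rfl fun A hA => ?_
        rw [excess]
        refine Finset.sum_congr rfl fun B hB => ?_
        have : i ∉ A := fun h => hout hA (hG.sub he) h hi
        simp [this]
      rw [this]
      exact mul_neg_of_pos_of_neg (by exact_mod_cast Finset.card_pos.2 ⟨_, hF0⟩) (hG.neg he hi)

lemma exists_deficient_add_four {n : ℕ} {F S : Finset (Finset ℕ)} (hD : Deficient F S)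
    (h0 : ∅ ∈ F) (hS : S ⊆ (Finset.Icc 1 n).powersetCard 3) :
    ∃ G T, Deficient G T ∧ ∅ ∈ G ∧ T ⊆ (Finset.Icc 1 (n + 4)).powersetCard 3 ∧
      T.card = S.card + 2 := by
  obtain ⟨G, hG, hG0⟩ := exists_deficient_four
  set σ : ℕ → ℕ := fun x => if x ≤ n then x else 2 * x + n + 4 with hσ
  set τ : ℕ → ℕ := fun x => if 1 ≤ x ∧ x ≤ 4 then x + n else 2 * x + n + 5 with hτ
  have hσi : Function.Injective σ := fun x y h => by
    simp only [hσ] at h; split_ifs at h <;> omega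
  have hτi : Function.Injective τ := fun x y h => by
    simp only [hτ] at h; split_ifs at h <;> omega
  have hστ : ∀ x y, σ x ≠ τ y := fun x y h => by
    simp only [hσ, hτ] at h; split_ifs at h <;> omega
  have hSσ : S.image (Finset.image σ) = S := by
    rw [Finset.image_congr (g := id), Finset.image_id]
    intro e he
    have he' := (Finset.mem_powersetCard.1 (hS he)).1
    rw [Finset.image_congr (g := id), Finset.image_id]; rfl
    intro x hx
    simp [hσ, (Finset.mem_Icc.1 (he' hx)).2]
  have hF' := hSσ ▸ hD.image hσi
  have hG' := hG.image hτi
  have hemp : ∀ {H : Finset (Finset ℕ)} (ρ : ℕ → ℕ), ∅ ∈ H → ∅ ∈ H.image (Finset.image ρ) :=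
    fun ρ h => Finset.mem_image.2 ⟨∅, h, by simp⟩
  have hdis : Disjoint ((F.image (Finset.image σ)).sup id) ((G.image (Finset.image τ)).sup id) := by
    refine Finset.disjoint_left.2 fun v hv hv' => ?_
    obtain ⟨A, hA, hvA⟩ := Finset.mem_sup.1 hv
    obtain ⟨B, hB, hvB⟩ := Finset.mem_sup.1 hv'
    obtain ⟨A, -, rfl⟩ := Finset.mem_image.1 hA
    obtain ⟨B, -, rfl⟩ := Finset.mem_image.1 hB
    obtain ⟨x, -, hx⟩ := Finset.mem_image.1 hvA
    obtain ⟨y, -, hy⟩ := Finset.mem_image.1 hvB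
    exact hστ x y (hx.trans hy.symm)
  have hT : ({{1, 2, 3}, {1, 2, 4}} : Finset (Finset ℕ)).image (Finset.image τ) =
      {{n + 1, n + 2, n + 3}, {n + 1, n + 2, n + 4}} := by
    simp [hτ, Finset.image_insert, add_comm]
  refine ⟨_, _, hF'.union hG' (hemp σ h0) (hemp τ hG0) hdis,
    Finset.mem_image₂.2 ⟨∅, hemp σ h0, ∅, hemp τ hG0, by simp⟩, ?_, ?_⟩
  · intro e he
    refine Finset.mem_powersetCard.2 ⟨fun x hx => ?_,
      (hF'.union hG' (hemp σ h0) (hemp τ hG0) hdis).card he⟩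
    rw [hT] at he
    rcases Finset.mem_union.1 he with he | he
    · have := Finset.mem_Icc.1 ((Finset.mem_powersetCard.1 (hS he)).1 hx)
      exact Finset.mem_Icc.2 ⟨this.1, by omega⟩
    · simp only [Finset.mem_insert, Finset.mem_singleton] at he
      rw [Finset.mem_Icc]
      rcases he with rfl | rfl <;> simp only [Finset.mem_insert,
        Finset.mem_singleton] at hx <;> omega
  · rw [Finset.card_union_of_disjoint,
    Finset.card_image_of_injective _ (Finset.image_injective hτi)]
    · rfl
    · rw [hT]
      refine Finset.disjoint_left.2 fun e he he' => ?_
      have : n + 1 ∈ e := by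
        simp only [Finset.mem_insert, Finset.mem_singleton] at he'
        rcases he' with rfl | rfl <;> simp
      have := Finset.mem_Icc.1 ((Finset.mem_powersetCard.1 (hS he)).1 this)
      omega

lemma exists_deficient_card (n : ℕ) (hn : 4 ≤ n) :
    ∃ F S, Deficient F S ∧ ∅ ∈ F ∧ S ⊆ (Finset.Icc 1 n).powersetCard 3 ∧ S.card = n / 2 := by
  have base : ∀ {m k : ℕ} {S : Finset (Finset ℕ)}, (∃ F, Deficient F S ∧ ∅ ∈ F) →
      S ⊆ (Finset.Icc 1 k).powersetCard 3 → k ≤ m → S.card = m / 2 →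
      ∃ F S, Deficient F S ∧ ∅ ∈ F ∧ S ⊆ (Finset.Icc 1 m).powersetCard 3 ∧ S.card = m / 2 := by
    rintro m k S ⟨F, hF, h0⟩ hS hkm hc
    exact ⟨F, S, hF, h0,
      hS.trans (Finset.powersetCard_mono (Finset.Icc_subset_Icc_right hkm)), hc⟩
  induction n using Nat.strong_induction_on with
  | _ n ih =>
    by_cases h8 : 8 ≤ n
    · obtain ⟨F, S, hF, h0, hS, hc⟩ := ih (n - 4) (by omega) (by omega)
      obtain ⟨G, T, hG, hG0, hT, hTc⟩ := exists_deficient_add_four hF h0 hS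
      rw [Nat.sub_add_cancel hn] at hT
      exact ⟨G, T, hG, hG0, hT, by omega⟩
    by_cases h6 : 6 ≤ n
    · exact base exists_deficient_six (k := 6) (by decide) h6
        (by rw [show n / 2 = 3 by omega]; decide)
    · exact base exists_deficient_four (k := 4) (by decide) hn
        (by rw [show n / 2 = 2 by omega]; decide)

lemma subset_gen (S : Finset (Finset ℕ)) : S ⊆ gen S := fun e he =>
  Finset.mem_image.2 ⟨{e}, by simpa using he, by simp⟩

lemma famU_gen (S : Finset (Finset ℕ)) : famU (gen S) = S.sup id := by
  refine le_antisymm (Finset.sup_le fun A hA => ?_) (Finset.sup_mono (subset_gen S))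
  obtain ⟨T, hT, rfl⟩ := Finset.mem_image.1 hA
  exact Finset.sup_mono (Finset.mem_powerset.1 (Finset.mem_filter.1 hT).1)

lemma UC.gen_subset {F S : Finset (Finset ℕ)} (hF : UC F) (h0 : ∅ ∈ F) (hS : S ⊆ F) :
    gen S ⊆ F := fun A hA => by
  obtain ⟨T, hT, rfl⟩ := Finset.mem_image.1 hA
  exact Finset.sup_mem (F : Set (Finset ℕ)) h0 hF T id fun e he =>
    hS (Finset.mem_powerset.1 (Finset.mem_filter.1 hT).1 he)

lemma excess_neg_iff {F : Finset (Finset ℕ)} {i : ℕ} :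
    excess F i < 0 ↔ 2 * (memFam F i).card < F.card := by
  have h := Finset.card_filter_add_card_filter_not (s := F) (i ∈ ·)
  rw [excess, Finset.sum_ite, memFam]
  simp only [Finset.sum_const, nsmul_eq_mul, mul_one, mul_neg]
  omega

lemma fc_gen_of_card {n : ℕ} {S : Finset (Finset ℕ)} (hS : S ⊆ (Finset.Icc 1 n).powersetCard 3)
    (hc : n < 2 * S.card) : FC (gen S) := by
  intro F hF hSF
  by_contra! h
  have hD : Deficient F S :=
    ⟨hF, fun e he => hSF (subset_gen S he), fun e he => (Finset.mem_powersetCard.1 (hS he)).2,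
      fun e he i hi => excess_neg_iff.2 (h i (famU_gen S ▸ Finset.mem_sup.2 ⟨e, he, hi⟩))⟩
  have h1 : S.sup id ⊆ Finset.Icc 1 n :=
    Finset.sup_le fun e he => (Finset.mem_powersetCard.1 (hS he)).1
  have h2 := Finset.card_le_card h1
  have h3 := hD.two_mul_card_le
  simp at h2
  omega

lemma Deficient.nonFC_gen {F S : Finset (Finset ℕ)} (hD : Deficient F S) (h0 : ∅ ∈ F) :
    NonFC (gen S) :=
  ⟨F, hD.uc, hD.uc.gen_subset h0 fun _ he => hD.sub he, fun i hi => by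
    obtain ⟨e, he, hie⟩ := Finset.mem_sup.1 (famU_gen S ▸ hi)
    exact excess_neg_iff.1 (hD.neg he hie)⟩

/-- The 3-sets conjecture of Morris: FC(3,n) = ⌊n/2⌋ + 1 for all n ≥ 4. -/
theorem three_sets_conjecture (n : ℕ) (hn : 4 ≤ n) :
    (∀ S : Finset (Finset ℕ), S ⊆ (Finset.Icc 1 n).powersetCard 3 →
      S.card = n / 2 + 1 → FC (gen S)) ∧
    (∃ S : Finset (Finset ℕ), S ⊆ (Finset.Icc 1 n).powersetCard 3 ∧
      S.card = n / 2 ∧ NonFC (gen S)) := by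
  refine ⟨fun S hS hc => fc_gen_of_card hS (by omega), ?_⟩
  obtain ⟨F, S, hD, h0, hS, hc⟩ := exists_deficient_card n hn
  exact ⟨S, hS, hc, hD.nonFC_gen h0⟩
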